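/- For every prime number p there exists an elliptic curve E defined over the finite field 𝔽_p with exactly p + 1 rational points, i.e. #E(𝔽_p) = p + 1 (equivalently, an elliptic curve over 𝔽_p whose Frobenius trace is zero; such a curve is supersingular). -/

import Mathlib

section

open Polynomial in
/-- The sum of the values of a polynomial of degree below `2 * (p - 1)` over `ZMod p`. -/
theorem ZMod.sum_eval_eq_neg_coeff {p : ℕ} [Fact p.Prime] (f : (ZMod p)[X])
    (hf : f.natDegree < 2 * (p - 1)) : ∑ x, f.eval x = -f.coeff (p - 1) := by
  have hp : 2 ≤ p := (Fact.out : p.Prime).two_le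
  have key : ∀ i ∈ Finset.range (2 * (p - 1)),
      ∑ x : ZMod p, x ^ i = if i = p - 1 then -1 else 0 := by
    intro i hi
    rw [Finset.mem_range] at hi
    rcases lt_trichotomy i (p - 1) with h | h | h
    · rw [if_neg h.ne]
      exact FiniteField.sum_pow_lt_card_sub_one _ i (by rwa [ZMod.card])
    · rw [if_pos h, h]
      calc ∑ x : ZMod p, x ^ (p - 1) = ∑ x : ZMod p, (1 - if x = 0 then 1 else 0) := by
            refine Finset.sum_congr rfl fun x _ ↦ ?_
            split_ifs with hx
            · simp [hx, show p - 1 ≠ 0 by lia]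
            · simp [ZMod.pow_card_sub_one_eq_one hx]
        _ = -1 := by simp
    · rw [if_neg h.ne']
      calc ∑ x : ZMod p, x ^ i = ∑ x : ZMod p, x ^ (i - (p - 1)) := by
            refine Finset.sum_congr rfl fun x _ ↦ ?_
            obtain ⟨j, hj, rfl⟩ : ∃ j, j ≠ 0 ∧ i = p - 1 + j := ⟨i - (p - 1), by lia, by lia⟩
            rw [add_tsub_cancel_left, pow_add]
            by_cases hx : x = 0
            · simp [hx, hj]
            · simp [ZMod.pow_card_sub_one_eq_one hx]
        _ = 0 := FiniteField.sum_pow_lt_card_sub_one _ _ (by rw [ZMod.card]; lia)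
  simp_rw [eval_eq_sum_range' hf]
  rw [Finset.sum_comm]
  simp_rw [← Finset.mul_sum]
  rw [Finset.sum_congr rfl fun i hi ↦ by rw [key i hi]]
  simp only [mul_ite, mul_neg, mul_one, mul_zero]
  rw [Finset.sum_ite_eq' (Finset.range (2 * (p - 1))) (p - 1), if_pos (by simp; lia)]

namespace WeierstrassCurve

/-- The short Weierstrass curve `y ^ 2 = x ^ 3 + a * x + b`. -/
def short {R : Type*} [CommRing R] (a b : R) : WeierstrassCurve R := ⟨0, 0, 0, a, b⟩

open Polynomial

/-- The cubic `X ^ 3 + a * X + b`. -/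
noncomputable def shortCubic {R : Type*} [CommRing R] (a b : R) : R[X] := X ^ 3 + C a * X + C b

theorem short_Δ {R : Type*} [CommRing R] (a b : R) :
    (short a b).Δ = -16 * (4 * a ^ 3 + 27 * b ^ 2) := by
  simp only [short, Δ, b₂, b₄, b₆, b₈]
  ring

theorem natDegree_shortCubic {R : Type*} [CommRing R] [Nontrivial R] (a b : R) :
    (shortCubic a b).natDegree = 3 := by
  unfold shortCubic
  compute_degree!

theorem natDegree_shortCubic_pow_le {R : Type*} [CommRing R] [Nontrivial R] (a b : R) (m : ℕ) :
    (shortCubic a b ^ m).natDegree ≤ 3 * m := by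
  have := natDegree_pow_le (p := shortCubic a b) (n := m)
  rw [natDegree_shortCubic] at this
  lia

theorem card_point_short {p : ℕ} [Fact p.Prime] (hp : p ≠ 2) (a b : ZMod p)
    [(short a b).IsElliptic] :
    (Nat.card (short a b).toAffine.Point : ℤ) =
      p + 1 + ∑ x, quadraticChar (ZMod p) ((shortCubic a b).eval x) := by
  have e : (short a b).toAffine.Point ≃
      Option ((x : ZMod p) × {y : ZMod p // y ^ 2 = (shortCubic a b).eval x}) :=
    { toFun := fun P ↦ match P with
        | .zero => none
        | .some x y h => some ⟨x, y, by
            have := ((short a b).toAffine.equation_iff x y).1 (Affine.equation_iff_nonsingular.2 h)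
            simpa [short, shortCubic] using this⟩
      invFun := fun P ↦ match P with
        | none => .zero
        | some ⟨x, y, h⟩ => .some x y (Affine.equation_iff_nonsingular.1
            (((short a b).toAffine.equation_iff x y).2 (by simpa [short, shortCubic] using h)))
      left_inv := by rintro (_ | _) <;> rfl
      right_inv := by rintro (_ | ⟨x, y, h⟩) <;> rfl }
  have hc : ringChar (ZMod p) ≠ 2 := by rwa [ZMod.ringChar_zmod_n]
  have hs (x : ZMod p) : (Fintype.card {y : ZMod p // y ^ 2 = (shortCubic a b).eval x} : ℤ) =
      quadraticChar (ZMod p) ((shortCubic a b).eval x) + 1 := by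
    rw [← quadraticChar_card_sqrts hc, Set.toFinset_card]
    rfl
  rw [Nat.card_congr e, Nat.card_eq_fintype_card, Fintype.card_option, Fintype.card_sigma]
  push_cast
  simp_rw [hs, Finset.sum_add_distrib]
  simp [ZMod.card]
  ring

/-- A power of a cubic with exponent `(p - 1) / 2` is not constant as a function on `ZMod p`. -/
theorem shortCubic_pow_not_const {p : ℕ} [Fact p.Prime] (hp : 5 ≤ p) (a b ε : ZMod p) :
    ∃ x, (shortCubic a b).eval x ^ (p / 2) ≠ ε := by
  by_contra! h
  set f := shortCubic a b with hf
  set m := p / 2 with hm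
  have hp2 : p = 2 * m + 1 := by
    have := (Fact.out : p.Prime).eq_two_or_odd
    lia
  have hd : f.natDegree = 3 := natDegree_shortCubic a b
  have hmon : f.Monic := by
    rw [hf]; unfold shortCubic; monicity!
  have hq : (X ^ p - X : (ZMod p)[X]).Monic := monic_X_pow_sub (by simp; lia)
  have hqd : (X ^ p - X : (ZMod p)[X]).natDegree = p :=
    FiniteField.X_pow_card_sub_X_natDegree_eq _ (by lia)
  obtain ⟨g, hg⟩ : (X ^ p - X : (ZMod p)[X]) ∣ f ^ m - C ε := by
    rw [← modByMonic_eq_zero_iff_dvd hq]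
    refine eq_zero_of_natDegree_lt_card_of_eval_eq_zero _ Function.injective_id (fun x ↦ ?_) ?_
    · have := congrArg (eval x) (modByMonic_add_div (f ^ m - C ε) (X ^ p - X))
      simpa [h] using this
    · rw [ZMod.card]
      exact (natDegree_modByMonic_lt _ hq (by intro h1; simp [h1] at hqd; lia)).trans_eq hqd
  have hg0 : g ≠ 0 := by
    rintro rfl
    have h1 : f ^ m = C ε := by simpa [sub_eq_zero] using hg
    have := congrArg natDegree h1
    rw [hmon.natDegree_pow, hd, natDegree_C] at this
    lia
  have hgd : g.natDegree + p = 3 * m := by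
    have := congrArg natDegree hg
    rw [natDegree_sub_C, hmon.natDegree_pow, hd, hq.natDegree_mul' hg0, hqd] at this
    lia
  have hder : (m : (ZMod p)[X]) * f ^ (m - 1) * derivative f =
      -g + (X ^ p - X) * derivative g := by
    have := congrArg derivative hg
    simpa [derivative_pow] using this
  have hfm : f ^ (m - 1) * f = f ^ m := by rw [← pow_succ]; congr 1; lia
  have hdvd : (X ^ p - X : (ZMod p)[X]) ∣ C ε * m * derivative f + g * f := by
    refine ⟨derivative g * f - m * derivative f * g, ?_⟩
    linear_combination (-(m : (ZMod p)[X]) * derivative f) * hg + f * hder -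
      (m : (ZMod p)[X]) * derivative f * hfm
  have hdf : (derivative f).natDegree ≤ 2 := (natDegree_derivative_le f).trans (by lia)
  have hzero : C ε * m * derivative f + g * f = 0 := by
    by_contra hne
    have h1 := natDegree_le_of_dvd hdvd hne
    have h2 : (C ε * (m : (ZMod p)[X]) * derivative f).natDegree ≤ 2 := by
      rw [← C_eq_natCast, ← C_mul]
      exact (natDegree_C_mul_le _ _).trans hdf
    have h3 : (g * f).natDegree ≤ g.natDegree + 3 := natDegree_mul_le.trans (by lia)
    have h4 := natDegree_add_le (C ε * (m : (ZMod p)[X]) * derivative f) (g * f)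
    lia
  have hfd : (C ε * (m : (ZMod p)[X]) * derivative f).natDegree = g.natDegree + 3 := by
    rw [eq_neg_of_add_eq_zero_left hzero, natDegree_neg, natDegree_mul hg0 hmon.ne_zero, hd]
  have : (C ε * (m : (ZMod p)[X]) * derivative f).natDegree ≤ 2 := by
    rw [← C_eq_natCast, ← C_mul]
    exact (natDegree_C_mul_le _ _).trans hdf
  lia

/-- If the Hasse invariant of `y ^ 2 = x ^ 3 + a * x + b` vanishes, the curve has `p + 1` points. -/
theorem card_point_short_of_coeff_eq_zero {p : ℕ} [Fact p.Prime] (hp : 5 ≤ p) (a b : ZMod p)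
    [(short a b).IsElliptic] (h : (shortCubic a b ^ (p / 2)).coeff (p - 1) = 0) :
    Nat.card (short a b).toAffine.Point = p + 1 := by
  have hp2 : p = 2 * (p / 2) + 1 := by
    have := (Fact.out : p.Prime).eq_two_or_odd
    lia
  have hc : ringChar (ZMod p) ≠ 2 := by rw [ZMod.ringChar_zmod_n]; lia
  set χ : ZMod p → ℤ := fun x ↦ quadraticChar (ZMod p) ((shortCubic a b).eval x) with hχ
  have hcard : (Nat.card (short a b).toAffine.Point : ℤ) = p + 1 + ∑ x, χ x :=
    card_point_short (by lia) a b
  have hχm (x : ZMod p) : (χ x : ZMod p) = (shortCubic a b).eval x ^ (p / 2) := by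
    rw [hχ, quadraticChar_eq_pow_of_char_ne_two' hc, ZMod.card]
  have hmod : (p : ℤ) ∣ ∑ x, χ x := by
    rw [← ZMod.intCast_zmod_eq_zero_iff_dvd, Int.cast_sum]
    simp_rw [hχm, ← eval_pow]
    rw [ZMod.sum_eval_eq_neg_coeff _ ((natDegree_shortCubic_pow_le a b _).trans_lt (by lia)), h,
      neg_zero]
  have hle (x : ZMod p) : |χ x| ≤ 1 := by
    rcases quadraticChar_isQuadratic (ZMod p) ((shortCubic a b).eval x) with h | h | h <;>
      simp only [hχ, h] <;> norm_num
  have hlt (ε : ℤ) (hε : ε = 1 ∨ ε = -1) : ∑ x, ε * χ x < p := by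
    have hle' (x : ZMod p) : ε * χ x ≤ 1 := by
      have := abs_le.1 (hle x)
      rcases hε with rfl | rfl <;> lia
    obtain ⟨x, hx⟩ := shortCubic_pow_not_const hp a b ε
    have : ∑ x, ε * χ x < ∑ x : ZMod p, (1 : ℤ) := by
      refine Finset.sum_lt_sum (fun x _ ↦ hle' x) ⟨x, Finset.mem_univ x, lt_of_le_of_ne (hle' x) ?_⟩
      intro h1
      refine hx ?_
      rw [← hχm]
      congr 1
      have := abs_le.1 (hle x)
      rcases hε with rfl | rfl <;> lia
    simpa [ZMod.card] using this
  have h1 := hlt 1 (Or.inl rfl)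
  have h2 := hlt (-1) (Or.inr rfl)
  simp only [one_mul, neg_mul, Finset.sum_neg_distrib] at h1 h2
  obtain ⟨c, hc⟩ := hmod
  have hc0 : c = 0 := by
    have : (0 : ℤ) < p := by lia
    rw [hc] at h1 h2
    have : c < 1 := by nlinarith
    have : -1 < c := by nlinarith
    lia
  rw [hc, hc0] at hcard
  simpa [← Nat.cast_inj (R := ℤ)] using hcard

end WeierstrassCurve

end

section

namespace WeierstrassCurve

open Polynomial

open scoped Differential in
/-- The differential equations satisfied by the Hasse invariant of the family
`y² = x³ - 27 c₄ x - 54 c₆` under a derivation obeying Ramanujan's identities. -/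
theorem hasse_coeff_deriv {p : ℕ} (hp : 5 ≤ p) (hodd : p % 2 = 1)
    {A : Type*} [CommRing A] [CharP A p] (θ : A → A) (hadd : ∀ a b, θ (a + b) = θ a + θ b)
    (hmul : ∀ a b, θ (a * b) = a * θ b + b * θ a)
    {e₂ e₄ e₆ : A} (h₂ : 12 * θ e₂ = e₂ ^ 2 - e₄) (h₄ : 3 * θ e₄ = e₂ * e₄ - e₆)
    (h₆ : 2 * θ e₆ = e₂ * e₆ - e₄ ^ 2) :
    ∃ W : A, 36 * θ ((shortCubic (-27 * e₄) (-54 * e₆) ^ (p / 2)).coeff (p - 1)) = -W ∧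
      36 * θ W = 0 := by
  let : Differential A :=
    ⟨Derivation.mk' (AddMonoidHom.toIntLinearMap (AddMonoidHom.mk' θ hadd)) hmul⟩
  change 12 * e₂′ = _ at h₂
  change 3 * e₄′ = _ at h₄
  change 2 * e₆′ = _ at h₆
  change ∃ W : A, 36 * (coeff _ _)′ = -W ∧ 36 * W′ = 0
  obtain ⟨m, rfl⟩ : ∃ m, p = 2 * m + 5 := ⟨(p - 5) / 2, by omega⟩
  have e1 : (2 * m + 5) / 2 = m + 2 := by omega
  have e2 : 2 * m + 5 - 1 = 2 * m + 4 := by omega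
  rw [e1, e2]
  have hchar : (2 : A) * m = -5 := by
    have := CharP.cast_eq_zero A (2 * m + 5)
    push_cast at this; linear_combination this
  have hcharX : (2 : A[X]) * m = -5 := by
    have := congrArg (C (R := A)) hchar
    rwa [map_mul, map_neg, map_natCast, map_ofNat, map_ofNat] at this
  have d27 : (-27 * e₄)′ = -27 * e₄′ := by
    have : (-27 : A)′ = 0 := by simpa using (Differential.deriv (R := A)).map_intCast (-27)
    rw [Derivation.leibniz, this]; simp
  have d54 : (-54 * e₆)′ = -54 * e₆′ := by
    have : (-54 : A)′ = 0 := by simpa using (Differential.deriv (R := A)).map_intCast (-54)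
    rw [Derivation.leibniz, this]; simp
  set f := shortCubic (-27 * e₄) (-54 * e₆) with hf
  have hf' : f = X ^ 3 + C (-27 * e₄) * X + C (-54 * e₆) := rfl
  have hd : derivative f = C 3 * X ^ 2 + C (-27 * e₄) := by
    rw [hf', show (C 3 : A[X]) = 3 from map_ofNat C 3]
    simp only [derivative_add, derivative_X_pow, derivative_mul, derivative_C, derivative_X]
    norm_num [show (C 3 : A[X]) = 3 from map_ofNat C 3]
  have hθ : Differential.mapCoeffs f = C (-27 * e₄′) * X + C (-54 * e₆′) := by
    rw [hf', map_add, map_add, Derivation.leibniz, Derivation.leibniz_pow,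
      Differential.mapCoeffs_C, Differential.mapCoeffs_C, Differential.mapCoeffs_X, d27, d54]
    simp [mul_comm]
  set g := f ^ (m + 2) with hg
  have hgd : C 2 * (f * derivative g) = - (derivative f * g) := by
    rw [hg, derivative_pow, map_natCast, map_ofNat, show m + 2 - 1 = m + 1 from rfl]
    push_cast
    linear_combination (f ^ (m + 2) * derivative f) * hcharX
  have hgθ : C 36 * Differential.mapCoeffs g =
      C (-9 * e₂) * g + C 3 * (X * g) + C 2 * (X ^ 2 * derivative g)
        + C (-6 * e₂) * (X * derivative g) + C (-36 * e₄) * derivative g := by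
    have key : C 36 * Differential.mapCoeffs f = C (18 * e₂) * f - C 6 * (X * f)
        + C 2 * (X ^ 2 * derivative f) + C (-6 * e₂) * (X * derivative f)
        + C (-36 * e₄) * derivative f := by
      have h4 := congrArg C h₄
      have h6 := congrArg C h₆
      rw [hθ, hd, hf']
      simp only [map_mul, map_sub, map_pow, map_neg, map_ofNat] at h4 h6 ⊢
      linear_combination (-324 * X) * h4 - 972 * h6
    have h1 : Differential.mapCoeffs g = (m + 2) * f ^ (m + 1) * Differential.mapCoeffs f := by
      rw [hg, Derivation.leibniz_pow]; simp [mul_assoc]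
    have h2 : derivative g = (m + 2) * f ^ (m + 1) * derivative f := by
      rw [hg, derivative_pow, map_natCast, show m + 2 - 1 = m + 1 from rfl]
      push_cast
      rfl
    have h3 : g = f ^ (m + 1) * f := by rw [hg, ← pow_succ]
    rw [h1, h2, h3]
    simp only [map_mul, map_neg, map_ofNat] at key ⊢
    linear_combination ((m + 2) * f ^ (m + 1)) * key +
      f ^ (m + 2) * (9 * C e₂ - 3 * X) * hcharX
  set a := g.coeff (2 * m + 4) with ha
  set b := g.coeff (2 * m + 3) with hb
  set c := g.coeff (2 * m + 2) with hc
  have hm1 : ((2 * m + 4 : ℕ) : A) + 1 = 0 := by push_cast; linear_combination hchar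
  have E1 : 36 * a′ = -3 * e₂ * a - b := by
    have := congrArg (coeff · (2 * m + 4)) hgθ
    simp only [coeff_add, coeff_C_mul, Differential.coeff_mapCoeffs, coeff_X_pow_mul',
      coeff_X_mul, coeff_derivative] at this
    simp only [show 2 ≤ 2 * m + 4 by omega, if_true,
      show 2 * m + 4 - 2 = 2 * m + 2 by omega, hm1, ← hb, ← ha] at this
    push_cast at this
    linear_combination this + (2 * b - 6 * e₂ * a) * hchar
  have E2 : 36 * b′ = 3 * e₂ * b - 3 * c + 36 * e₄ * a := by
    have := congrArg (coeff · (2 * m + 3)) hgθ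
    simp only [coeff_add, coeff_C_mul, Differential.coeff_mapCoeffs, coeff_X_pow_mul',
      coeff_X_mul, coeff_derivative] at this
    simp only [show 2 ≤ 2 * m + 3 by omega, if_true,
      show 2 * m + 3 - 2 = 2 * m + 1 by omega, ← hb, ← hc] at this
    push_cast at this
    linear_combination this + (2 * c - 6 * e₂ * b - 36 * e₄ * a) * hchar
  have E3 : 3 * c = 27 * e₄ * a := by
    have h : f * derivative g = X ^ 3 * derivative g + C (-27 * e₄) * (X * derivative g)
        + C (-54 * e₆) * derivative g := by rw [hf']; ring
    have h' : derivative f * g = C 3 * (X ^ 2 * g) + C (-27 * e₄) * g := by rw [hd]; ring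
    have := congrArg (coeff · (2 * m + 4)) hgd
    rw [h, h'] at this
    simp only [coeff_add, coeff_neg, coeff_C_mul, coeff_X_pow_mul',
      coeff_X_mul, coeff_derivative] at this
    simp only [show 2 ≤ 2 * m + 4 by omega, show 3 ≤ 2 * m + 4 by omega, if_true,
      show 2 * m + 4 - 2 = 2 * m + 2 by omega,
      show 2 * m + 4 - 3 = 2 * m + 1 by omega, hm1, ← hc, ← ha] at this
    push_cast at this
    linear_combination -this + (2 * c - 54 * e₄ * a) * hchar
  refine ⟨3 * e₂ * a + b, by linear_combination E1, ?_⟩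
  have d3 : (3 : A)′ = 0 := by simpa using (Differential.deriv (R := A)).map_natCast 3
  rw [map_add, Derivation.leibniz, Derivation.leibniz, d3]
  simp only [smul_eq_mul, mul_zero, add_zero]
  linear_combination 9 * a * h₂ + 3 * e₂ * E1 + E2 - E3

end WeierstrassCurve

end

section

open Finset

universe u

/-- A monomial of weighted degree `6 * n` in `c₄`, `c₆` (of weights `2` and `3`), as a form of
degree `n` in `c₄ ^ 3` and `(c₄ ^ 3 - c₆ ^ 2) / 1728`. -/
theorem exists_monomial_eq_sum_cube_discriminant {i k n : ℕ} (h : 2 * i + 3 * k = 6 * n) :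
    ∃ a : ℕ → ℤ, ∀ (R : Type u) [CommRing R] (x y d : R), 1728 * d = x ^ 3 - y ^ 2 →
      x ^ i * y ^ k = ∑ s ∈ range (n + 1), (a s : R) * (x ^ 3) ^ s * d ^ (n - s) := by
  obtain ⟨i, rfl⟩ : ∃ j, i = 3 * j := ⟨i / 3, by omega⟩
  obtain ⟨k, rfl⟩ : ∃ j, k = 2 * j := ⟨k / 2, by omega⟩
  obtain rfl : n = i + k := by omega
  refine ⟨fun s ↦ if i ≤ s then (k.choose (s - i)) * (-1728) ^ (i + k - s) else 0, ?_⟩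
  intro R _ x y d hd
  have hy : y ^ 2 = x ^ 3 + (-1728) * d := by linear_combination hd
  rw [pow_mul, pow_mul, hy, add_pow, mul_sum, show i + k + 1 = i + (k + 1) by omega,
    sum_range_add _ i, sum_eq_zero (s := range i), zero_add]
  · refine sum_congr rfl fun s hs ↦ ?_
    rw [mem_range] at hs
    simp only [le_add_iff_nonneg_right, zero_le, if_true, add_tsub_cancel_left,
      show i + k - (i + s) = k - s by omega]
    push_cast
    rw [mul_pow]
    ring
  · intro s hs
    rw [mem_range] at hs
    simp [show ¬ i ≤ s by omega]

/-- A weighted homogeneous polynomial of degree `6 * n` in variables of weights `2` and `3`, as a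
form of degree `n` in `c₄ ^ 3` and `(c₄ ^ 3 - c₆ ^ 2) / 1728`. -/
theorem MvPolynomial.IsWeightedHomogeneous.exists_eq_sum_cube_discriminant {n : ℕ}
    {P : MvPolynomial (Fin 2) ℤ} (hP : P.IsWeightedHomogeneous ![2, 3] (6 * n)) :
    ∃ a : ℕ → ℤ, ∀ (R : Type u) [CommRing R] (x y d : R), 1728 * d = x ^ 3 - y ^ 2 →
      MvPolynomial.aeval ![x, y] P =
        ∑ s ∈ range (n + 1), (a s : R) * (x ^ 3) ^ s * d ^ (n - s) := by
  have key (e : Fin 2 →₀ ℕ) : ∃ a : ℕ → ℤ, MvPolynomial.coeff e P ≠ 0 →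
      ∀ (R : Type u) [CommRing R] (x y d : R), 1728 * d = x ^ 3 - y ^ 2 →
      x ^ e 0 * y ^ e 1 = ∑ s ∈ range (n + 1), (a s : R) * (x ^ 3) ^ s * d ^ (n - s) := by
    by_cases he : MvPolynomial.coeff e P = 0
    · exact ⟨0, fun h ↦ absurd he h⟩
    · have := hP he
      rw [Finsupp.weight_apply, Finsupp.sum_fintype _ _ (by simp)] at this
      simp only [Fin.sum_univ_two, smul_eq_mul, Matrix.cons_val_zero, Matrix.cons_val_one] at this
      obtain ⟨a, ha⟩ := exists_monomial_eq_sum_cube_discriminant (i := e 0) (k := e 1) (n := n)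
        (by omega)
      exact ⟨a, fun _ ↦ ha⟩
  choose a ha using key
  refine ⟨fun s ↦ ∑ e ∈ P.support, P.coeff e * a e s, fun R _ x y d hd ↦ ?_⟩
  rw [MvPolynomial.aeval_def, MvPolynomial.eval₂_eq']
  push_cast
  simp only [Finset.sum_mul]
  rw [sum_comm]
  refine sum_congr rfl fun e he ↦ ?_
  simp only [Fin.prod_univ_two, Matrix.cons_val_zero, Matrix.cons_val_one]
  rw [ha e (MvPolynomial.mem_support_iff.1 he) R x y d hd, mul_sum]
  exact sum_congr rfl fun s _ ↦ by simp [mul_assoc]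

namespace WeierstrassCurve

open Polynomial

/-- The twelfth power of the central coefficient of a power of the cubic, as a form in `c₄ ^ 3` and
the discriminant. -/
theorem exists_coeff_shortCubic_pow_eq (m : ℕ) :
    ∃ a : ℕ → ℤ, ∀ (R : Type u) [CommRing R] (x y d : R), 1728 * d = x ^ 3 - y ^ 2 →
      (((shortCubic (-27 * x) (-54 * y)) ^ m).coeff (2 * m)) ^ 12 =
        ∑ s ∈ range (2 * m + 1), (a s : R) * (x ^ 3) ^ s * d ^ (2 * m - s) := by
  let F : MvPolynomial (Fin 3) ℤ := .X 0 ^ 3 + .C (-27) * (.X 1 * .X 0) + .C (-54) * .X 2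
  let w : Fin 3 → ℕ := ![1, 2, 3]
  have hX (i : Fin 3) : (MvPolynomial.X i : MvPolynomial (Fin 3) ℤ).IsWeightedHomogeneous w (w i) :=
    MvPolynomial.isWeightedHomogeneous_X _ _ _
  have hF : (F ^ m).IsWeightedHomogeneous w (m * 3) := by
    rw [← smul_eq_mul]
    exact (((hX 0).pow 3).add (((hX 1).mul (hX 0)).C_mul _) |>.add ((hX 2).C_mul _)).pow m
  let Q : MvPolynomial (Fin 2) ℤ := ∑ e ∈ (F ^ m).support with e 0 = 2 * m,
    .C ((F ^ m).coeff e) * (.X 0 ^ e 1 * .X 1 ^ e 2)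
  have hQ : Q.IsWeightedHomogeneous ![2, 3] m := by
    refine MvPolynomial.IsWeightedHomogeneous.sum _ _ _ fun e he ↦ ?_
    rw [mem_filter, MvPolynomial.mem_support_iff] at he
    have h := hF he.1
    rw [Finsupp.weight_apply, Finsupp.sum_fintype _ _ (by simp)] at h
    simp only [Fin.sum_univ_three, smul_eq_mul, w, Matrix.cons_val_zero, Matrix.cons_val_one,
      Matrix.cons_val_two, Matrix.tail_cons, Matrix.head_cons, he.2] at h
    have hm : m = e 1 * 2 + e 2 * 3 := by omega
    have := (((MvPolynomial.isWeightedHomogeneous_X ℤ ![2, 3] (0 : Fin 2)).pow (e 1)).mul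
      ((MvPolynomial.isWeightedHomogeneous_X ℤ ![2, 3] (1 : Fin 2)).pow (e 2))).C_mul
        ((F ^ m).coeff e)
    simpa [← hm] using this
  have hQ' : (Q ^ 12).IsWeightedHomogeneous ![2, 3] (6 * (2 * m)) := by
    have := hQ.pow 12
    rwa [smul_eq_mul, show 12 * m = 6 * (2 * m) by ring] at this
  obtain ⟨a, ha⟩ := hQ'.exists_eq_sum_cube_discriminant
  refine ⟨a, fun R _ x y d hd ↦ ?_⟩
  rw [← ha R x y d hd, map_pow]
  congr 1
  have hev : shortCubic (-27 * x) (-54 * y) ^ m =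
      MvPolynomial.aeval ![(X : R[X]), C x, C y] (F ^ m) := by
    rw [map_pow]
    congr 1
    simp [F, shortCubic, show (C 27 : R[X]) = 27 from map_ofNat C 27,
      show (C 54 : R[X]) = 54 from map_ofNat C 54]
    ring
  rw [hev, MvPolynomial.aeval_def, MvPolynomial.eval₂_eq', finsetSum_coeff]
  simp only [Q, map_sum, map_mul, map_pow, MvPolynomial.aeval_X, Fin.prod_univ_three]
  rw [sum_filter]
  refine sum_congr rfl fun e _ ↦ ?_
  simp only [Matrix.cons_val_zero, Matrix.cons_val_one, Matrix.cons_val, eq_intCast,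
    ← C_pow, mul_assoc, ← C_mul]
  rw [coeff_intCast_mul, coeff_mul_C, coeff_X_pow, ite_mul, one_mul, zero_mul, mul_ite, mul_zero]
  simp [eq_comm]

end WeierstrassCurve

end

section

open Finset

namespace PowerSeries

/-- The monomials of degree `n` in a unit series `S` and a uniformizer `D` have independent
`n`-jets. -/
theorem eq_zero_of_coeff_sum_pow_mul_pow {R : Type*} [CommRing R] {S D : R⟦X⟧}
    (hS : constantCoeff S = 1) (hD₀ : constantCoeff D = 0) (hD₁ : coeff 1 D = 1) {n : ℕ} {r : ℕ → R}
    (h : ∀ j ≤ n, coeff j (∑ s ∈ range (n + 1), C (r s) * S ^ s * D ^ (n - s)) = 0) :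
    ∀ s ≤ n, r s = 0 := by
  obtain ⟨U, rfl⟩ := X_dvd_iff.2 hD₀
  have hU : constantCoeff U = 1 := by
    rw [← hD₁, show (1 : ℕ) = 0 + 1 from rfl, coeff_succ_X_mul, coeff_zero_eq_constantCoeff]
  suffices ∀ t ≤ n, r (n - t) = 0 by
    intro s hs
    simpa [Nat.sub_sub_self hs] using this (n - s) (by omega)
  intro t
  induction t using Nat.strong_induction_on with
  | _ t ih =>
    intro ht
    have h1 := h t ht
    rw [map_sum, Finset.sum_eq_single (n - t)] at h1
    · rw [Nat.sub_sub_self ht, mul_pow, mul_left_comm, coeff_X_pow_mul', if_pos le_rfl,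
        Nat.sub_self, coeff_zero_eq_constantCoeff] at h1
      simpa [hS, hU] using h1
    · intro s hs hst
      rw [mem_range] at hs
      rcases lt_or_gt_of_ne hst with h2 | h2
      · rw [mul_pow, mul_left_comm, coeff_X_pow_mul', if_neg (by omega)]
      · have := ih (n - s) (by omega) (by omega)
        rw [Nat.sub_sub_self (by omega)] at this
        simp [this]
    · intro h2
      exact absurd (mem_range.2 (by omega)) h2

end PowerSeries

namespace WeierstrassCurve

open PowerSeries

/-- Suppose power series `E₂, E₄, E₆` over a field of characteristic `p` satisfy Ramanujan's
identities, and that a form `h` of degree `p - 1` takes the value `-1` at `(E₄ ^ 3, D)`, with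
`1728 * D = E₄ ^ 3 - E₆ ^ 2`. Then a zero of `h` is a zero of the Hasse invariant. -/
theorem hasse_coeff_eq_zero {p : ℕ} [Fact p.Prime] (hp : 5 ≤ p) {k : Type*} [Field k] [CharP k p]
    {E₂ E₄ E₆ D : k⟦X⟧}
    (h₂ : 12 * (X * d⁄dX k E₂) = E₂ ^ 2 - E₄) (h₄ : 3 * (X * d⁄dX k E₄) = E₂ * E₄ - E₆)
    (h₆ : 2 * (X * d⁄dX k E₆) = E₂ * E₆ - E₄ ^ 2) (hD : 1728 * D = E₄ ^ 3 - E₆ ^ 2)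
    (hE₀ : constantCoeff E₄ = 1) (hD₀ : constantCoeff D = 0) (hD₁ : coeff 1 D = 1) {h : ℕ → k}
    (hh : ∑ s ∈ range p, C (h s) * (E₄ ^ 3) ^ s * D ^ (p - 1 - s) = -1)
    {x y d : k} (hd : 1728 * d = x ^ 3 - y ^ 2)
    (hz : ∑ s ∈ range p, h s * (x ^ 3) ^ s * d ^ (p - 1 - s) = 0) :
    ((shortCubic (-27 * x) (-54 * y)) ^ (p / 2)).coeff (p - 1) = 0 := by
  have hprime : p.Prime := Fact.out
  have hodd : p % 2 = 1 := Nat.odd_iff.1 (hprime.odd_of_ne_two (by omega))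
  have h36 : (36 : k) ≠ 0 := by
    intro h0
    have : ((36 : ℕ) : k) = 0 := by exact_mod_cast h0
    rw [CharP.cast_eq_zero_iff k p, show 36 = 2 ^ 2 * 3 ^ 2 by norm_num, hprime.dvd_mul] at this
    rcases this with h1 | h1 <;>
    · have := Nat.le_of_dvd (by norm_num) (hprime.dvd_of_dvd_pow h1)
      omega
  obtain ⟨a, ha⟩ := exists_coeff_shortCubic_pow_eq (p / 2)
  rw [show 2 * (p / 2) = p - 1 by omega, show p - 1 + 1 = p by omega] at ha
  set A := ((shortCubic (-27 * E₄) (-54 * E₆)) ^ (p / 2)).coeff (p - 1) with hA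
  have hθ : ∀ j : ℕ, (j : k) * coeff j (A ^ 12) = 0 := by
    have hder (F : k⟦X⟧) (j : ℕ) : coeff j (X * d⁄dX k F) = j * coeff j F := by
      cases j with
      | zero => simp
      | succ j => rw [coeff_succ_X_mul, coeff_derivative]; push_cast; ring
    have : CharP k⟦X⟧ p := charP_of_injective_algebraMap (algebraMap k k⟦X⟧).injective p
    obtain ⟨W, hW, hW'⟩ := hasse_coeff_deriv hp hodd (fun F ↦ X * d⁄dX k F)
      (fun a b ↦ by rw [map_add, mul_add])
      (fun a b ↦ by rw [Derivation.leibniz]; simp only [smul_eq_mul]; ring) h₂ h₄ h₆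
    have c36 : (36 : k⟦X⟧) = C 36 := (map_ofNat C 36).symm
    rw [← hA, c36] at hW
    rw [c36] at hW'
    have hA' : X * d⁄dX k A = 0 := by
      ext j
      have h1 := congrArg (coeff j) hW
      have h2 := congrArg (coeff j) hW'
      rw [coeff_C_mul, hder, map_neg] at h1
      rw [coeff_C_mul, hder, map_zero] at h2
      rw [hder, map_zero]
      by_cases hj : (j : k) = 0
      · rw [hj, zero_mul]
      · have h3 : coeff j W = 0 := by simpa [h36, hj] using h2
        rw [h3, neg_zero] at h1
        exact (mul_eq_zero.1 h1).resolve_left h36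
    intro j
    rw [← hder, Derivation.leibniz_pow, (mul_eq_zero.1 hA').resolve_left X_ne_zero]
    simp
  set u := constantCoeff (A ^ 12) with hu
  have hr : ∀ s ≤ p - 1, (a s : k) + u * h s = 0 := by
    have hS : constantCoeff (E₄ ^ 3) = 1 := by simp [hE₀]
    refine eq_zero_of_coeff_sum_pow_mul_pow hS hD₀ hD₁ (n := p - 1) fun j hj ↦ ?_
    have e : ∑ s ∈ range (p - 1 + 1), C ((a s : k) + u * h s) * (E₄ ^ 3) ^ s * D ^ (p - 1 - s) =
        A ^ 12 - C u := by
      have h1 := ha k⟦X⟧ E₄ E₆ D hD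
      rw [h1, show p - 1 + 1 = p by omega, sub_eq_add_neg, ← mul_neg_one, ← hh, mul_sum,
        ← sum_add_distrib]
      refine sum_congr rfl fun s _ ↦ ?_
      rw [map_add, map_mul, map_intCast]
      ring
    rw [e, map_sub, coeff_C]
    split_ifs with hj0
    · rw [hj0, hu, coeff_zero_eq_constantCoeff, sub_self]
    · rw [sub_zero]
      refine (mul_eq_zero.1 (hθ j)).resolve_left fun h0 ↦ ?_
      rw [CharP.cast_eq_zero_iff k p] at h0
      have := Nat.le_of_dvd (by omega) h0
      omega
  have h12 := ha k x y d hd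
  refine pow_eq_zero_iff (n := 12) (by norm_num) |>.1 (h12.trans ?_)
  rw [show (0 : k) = -u * 0 by simp, ← hz, mul_sum]
  refine sum_congr rfl fun s hs ↦ ?_
  rw [mem_range] at hs
  linear_combination ((x ^ 3) ^ s * d ^ (p - 1 - s)) * hr s (by omega)

end WeierstrassCurve

end

section

open UpperHalfPlane hiding I
open Complex Function
open scoped Manifold PowerSeries Topology

/-- The power series `c` is an expansion of `f` in the parameter `exp (2πiτ / h)`. -/
def HasQExp (h : ℝ) (f : ℍ → ℂ) (c : ℂ⟦X⟧) : Prop :=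
  ∀ τ : ℍ, HasSum (fun m ↦ c.coeff m • Periodic.qParam h τ ^ m) (f τ)

theorem hasSum_of_eq {F G : ℕ → ℂ} {a : ℂ} (hG : HasSum G a) (h : ∀ m, F m = G m) : HasSum F a :=
  (funext h : F = G) ▸ hG

namespace HasQExp

variable {h : ℝ} {f g : ℍ → ℂ} {c d : ℂ⟦X⟧}

theorem add (hf : HasQExp h f c) (hg : HasQExp h g d) : HasQExp h (f + g) (c + d) := fun τ ↦ by
  simpa [add_mul] using (hf τ).add (hg τ)

theorem sub (hf : HasQExp h f c) (hg : HasQExp h g d) : HasQExp h (f - g) (c - d) := fun τ ↦ by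
  simpa [sub_mul] using (hf τ).sub (hg τ)

theorem const (a : ℂ) : HasQExp h (fun _ ↦ a) (PowerSeries.C a) := fun τ ↦ by
  convert hasSum_single 0 fun m hm ↦ ?_ using 1
  · simp
  · simp [PowerSeries.coeff_C, hm]

theorem mul (hf : HasQExp h f c) (hg : HasQExp h g d) : HasQExp h (f * g) (c * d) := fun τ ↦ by
  have h1 := summable_norm_iff.2 (hf τ).summable
  have h2 := summable_norm_iff.2 (hg τ).summable
  have h3 := (summable_norm_sum_mul_antidiagonal_of_summable_norm h1 h2).of_norm.hasSum
  rw [← tsum_mul_tsum_eq_tsum_sum_antidiagonal_of_summable_norm h1 h2, (hf τ).tsum_eq,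
    (hg τ).tsum_eq] at h3
  refine hasSum_of_eq h3 fun m ↦ ?_
  rw [PowerSeries.coeff_mul, Finset.sum_smul]
  refine Finset.sum_congr rfl fun x hx ↦ ?_
  rw [← Finset.HasAntidiagonal.mem_antidiagonal.1 hx]
  simp only [smul_eq_mul, pow_add]
  ring

theorem const_mul (hf : HasQExp h f c) (a : ℂ) :
    HasQExp h (fun τ ↦ a * f τ) (PowerSeries.C a * c) :=
  (const a).mul hf

theorem prod {ι : Type*} (s : Finset ι) {f : ι → ℍ → ℂ} {c : ι → ℂ⟦X⟧}
    (hf : ∀ i ∈ s, HasQExp h (f i) (c i)) : HasQExp h (∏ i ∈ s, f i) (∏ i ∈ s, c i) := by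
  classical
  induction s using Finset.induction_on with
  | empty => simpa using! const (h := h) 1
  | insert i s hi ih =>
    rw [Finset.prod_insert hi, Finset.prod_insert hi]
    exact (hf i (by simp)).mul (ih fun j hj ↦ hf j (by simp [hj]))

theorem pow (hf : HasQExp h f c) (n : ℕ) : HasQExp h (f ^ n) (c ^ n) := by
  simpa using prod (Finset.range n) fun _ _ ↦ hf

theorem sum {ι : Type*} (s : Finset ι) {f : ι → ℍ → ℂ} {c : ι → ℂ⟦X⟧}
    (hf : ∀ i ∈ s, HasQExp h (f i) (c i)) : HasQExp h (∑ i ∈ s, f i) (∑ i ∈ s, c i) := fun τ ↦ by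
  simpa [Finset.sum_mul] using hasSum_sum fun i hi ↦ hf i hi τ

theorem unique (hh : 0 < h) (hc : HasQExp h f c) (hd : HasQExp h f d) : c = d := by
  have h0 : HasQExp h (0 : C(ℍ, ℂ)) (c - d) := fun τ ↦ by
    have := hc.sub hd τ
    rwa [sub_self] at this
  have h1 : HasQExp h (0 : C(ℍ, ℂ)) 0 := fun τ ↦ by simp
  have han : AnalyticAt ℂ (cuspFunction h (0 : C(ℍ, ℂ))) 0 :=
    analyticAt_cuspFunction_zero hh (fun z ↦ rfl) mdifferentiable_const
      (Filter.const_boundedAtFilter _ _)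
  refine sub_eq_zero.1 (PowerSeries.ext fun m ↦ ?_)
  rw [qExpansion_coeff_unique _ hh han h0 m, ← qExpansion_coeff_unique _ hh han h1 m]

theorem norm_qParam_le (hh : 0 < h) {y : ℝ} {z : ℂ} (hz : y ≤ z.im) :
    ‖Periodic.qParam h z‖ ≤ ‖Periodic.qParam h (I * y)‖ := by
  rw [Periodic.norm_qParam, Periodic.norm_qParam, Real.exp_le_exp]
  have : 0 ≤ 2 * Real.pi / h := by positivity
  have h1 : (I * y).im = y := by simp
  rw [h1]
  have := mul_le_mul_of_nonneg_left hz this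
  have e (x : ℝ) : -2 * Real.pi * x / h = -(2 * Real.pi / h * x) := by ring
  rw [e, e]
  linarith

theorem eq_tsum_comp_ofComplex (hf : HasQExp h f c) {z : ℂ} (hz : 0 < z.im) :
    (f ∘ ofComplex) z = ∑' m, c.coeff m • Periodic.qParam h z ^ m := by
  simpa [ofComplex_apply_of_im_pos hz] using (hf ⟨z, hz⟩).tsum_eq.symm

theorem exists_bound (hh : 0 < h) (hf : HasQExp h f c) {y : ℝ} (hy : 0 < y) :
    ∃ u : ℕ → ℝ, Summable u ∧ ∀ m (z : ℂ), z ∈ {z : ℂ | y < z.im} →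
      ‖c.coeff m • Periodic.qParam h z ^ m‖ ≤ u m := by
  refine ⟨fun m ↦ ‖c.coeff m • Periodic.qParam h (I * y) ^ m‖,
    summable_norm_iff.2 (hf ⟨I * y, by simpa⟩).summable, fun m z hz ↦ ?_⟩
  simp only [norm_smul, norm_pow]
  gcongr
  exact norm_qParam_le hh (le_of_lt hz)

theorem differentiable_qParam (h : ℝ) : Differentiable ℂ (Periodic.qParam h) := by
  unfold Periodic.qParam
  fun_prop

theorem hasDerivAt_qParam (z : ℂ) : HasDerivAt (Periodic.qParam 1)
    (2 * Real.pi * I * Periodic.qParam 1 z) z := by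
  unfold Periodic.qParam
  have := (((hasDerivAt_id z).const_mul (2 * Real.pi * I)).div_const ((1 : ℝ) : ℂ)).cexp
  simpa [mul_comm] using this

theorem isOpen_lt_im (y : ℝ) : IsOpen {z : ℂ | y < z.im} :=
  isOpen_lt continuous_const continuous_im

theorem mdifferentiable (hh : 0 < h) (hf : HasQExp h f c) : MDiff f := by
  rw [UpperHalfPlane.mdifferentiable_iff]
  intro z hz
  obtain ⟨u, hu, hu'⟩ := hf.exists_bound hh (half_pos hz)
  have hd := differentiableOn_tsum_of_summable_norm hu
    (fun m ↦ ((differentiable_qParam h).fun_pow m |>.fun_const_smul (c.coeff m)).differentiableOn)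
    (isOpen_lt_im _) hu'
  refine DifferentiableAt.differentiableWithinAt ?_
  refine (hd.differentiableAt ((isOpen_lt_im _).mem_nhds
    (show z.im / 2 < z.im from half_lt_self hz))).congr_of_eventuallyEq ?_
  filter_upwards [(isOpen_lt_im (z.im / 2)).mem_nhds
    (show z.im / 2 < z.im from half_lt_self hz)] with w hw
  exact hf.eq_tsum_comp_ofComplex ((half_pos hz).trans hw)

theorem normalizedDeriv (hf : HasQExp 1 f c) :
    HasQExp 1 (Derivative.normalizedDerivOfComplex f)
      (PowerSeries.X * PowerSeries.derivative ℂ c) := by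
  intro τ
  obtain ⟨u, hu, hu'⟩ := hf.exists_bound one_pos (half_pos τ.im_pos)
  have hd := hasSum_deriv_of_summable_norm hu
    (fun m ↦ ((differentiable_qParam 1).fun_pow m |>.fun_const_smul (c.coeff m)).differentiableOn)
    (isOpen_lt_im _) hu' (show (τ : ℂ) ∈ {z : ℂ | τ.im / 2 < z.im} from half_lt_self τ.im_pos)
  have he : deriv (f ∘ ofComplex) τ =
      deriv (fun z ↦ ∑' m, c.coeff m • Periodic.qParam 1 z ^ m) τ := by
    refine Filter.EventuallyEq.deriv_eq ?_
    filter_upwards [(isOpen_lt_im (τ.im / 2)).mem_nhds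
      (show (τ : ℂ).im / 2 < (τ : ℂ).im from half_lt_self τ.im_pos)] with w hw
    exact hf.eq_tsum_comp_ofComplex ((half_pos τ.im_pos).trans hw)
  have := hd.mul_left (2 * Real.pi * I)⁻¹
  rw [Derivative.normalizedDerivOfComplex, he]
  refine hasSum_of_eq this fun m ↦ ?_
  have h1 := (((hasDerivAt_qParam (τ : ℂ)).fun_pow m).const_mul (c.coeff m)).deriv
  simp only [smul_eq_mul]
  rw [h1]
  cases m with
  | zero => simp
  | succ m =>
    rw [PowerSeries.coeff_succ_X_mul, PowerSeries.coeff_derivative]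
    have := two_pi_I_ne_zero
    field_simp
    push_cast
    simp [pow_succ]
    ring

end HasQExp

end

section

open UpperHalfPlane hiding I
open Complex Function ModularGroup
open scoped Manifold PowerSeries Topology ModularForm MatrixGroups CongruenceSubgroup

/-- The function `f` on the upper half plane is a modular form of level one and weight `k`. -/
def IsLevelOne (k : ℤ) (f : ℍ → ℂ) : Prop :=
  ∃ g : ModularForm 𝒮ℒ k, ⇑g = f

namespace IsLevelOne

variable {k l : ℤ} {f g : ℍ → ℂ} {c : ℂ⟦X⟧}

theorem of_hasQExp {h : ℝ} (hh : 0 < h) (hf : HasQExp h f c) (hT : ∀ τ, f (T • τ) = f τ)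
    (hS : ∀ τ : ℍ, f (S • τ) = (τ : ℂ) ^ k * f τ) : IsLevelOne k f := by
  have hγ : ∀ γ : SL(2, ℤ), f ∣[k] γ = f := by
    refine SlashInvariantForm.slash_action_generators_SL2Z ?_ ?_
    · ext τ
      rw [ModularForm.SL_slash_apply, hS, ModularGroup.denom_S, mul_comm, ← mul_assoc,
        ← zpow_add₀ (UpperHalfPlane.ne_zero τ)]
      simp
    · ext τ
      have h1 : denom T τ = 1 := by
        rw [ModularGroup.denom_apply]
        simp [T]
      rw [ModularForm.SL_slash_apply, hT, h1]
      simp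
  refine ⟨⟨⟨f, ?_⟩, hf.mdifferentiable hh, fun {c} hc ↦ ?_⟩, rfl⟩
  · rintro _ ⟨γ, rfl⟩
    exact hγ γ
  · refine (OnePoint.isBoundedAt_iff_forall_SL2Z hc).2 fun γ _ ↦ ?_
    change IsBoundedAtImInfty (f ∣[k] γ)
    rw [hγ]
    exact isBoundedAtImInfty_of_hasSum_qExpansion hh hf

theorem apply_smul (hf : IsLevelOne k f) (γ : SL(2, ℤ)) (τ : ℍ) :
    f (γ • τ) = (γ 1 0 * τ + γ 1 1 : ℂ) ^ k * f τ := by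
  obtain ⟨g, rfl⟩ := hf
  exact SlashInvariantForm.slash_action_eqn' g (MonoidHom.mem_range.2 ⟨γ, rfl⟩) τ

theorem apply_T (hf : IsLevelOne k f) (τ : ℍ) : f (T • τ) = f τ := by
  rw [hf.apply_smul]
  simp [T]

theorem apply_S (hf : IsLevelOne k f) (τ : ℍ) : f (S • τ) = (τ : ℂ) ^ k * f τ := by
  rw [hf.apply_smul]
  simp [S]

theorem add (hf : IsLevelOne k f) (hg : IsLevelOne k g) : IsLevelOne k (f + g) := by
  obtain ⟨f, rfl⟩ := hf
  obtain ⟨g, rfl⟩ := hg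
  exact ⟨f + g, rfl⟩

theorem sub (hf : IsLevelOne k f) (hg : IsLevelOne k g) : IsLevelOne k (f - g) := by
  obtain ⟨f, rfl⟩ := hf
  obtain ⟨g, rfl⟩ := hg
  exact ⟨f - g, rfl⟩

theorem const_mul (hf : IsLevelOne k f) (a : ℂ) : IsLevelOne k (fun τ ↦ a * f τ) := by
  obtain ⟨f, rfl⟩ := hf
  exact ⟨a • f, rfl⟩

theorem mul (hf : IsLevelOne k f) (hg : IsLevelOne l g) : IsLevelOne (k + l) (f * g) := by
  obtain ⟨f, rfl⟩ := hf
  obtain ⟨g, rfl⟩ := hg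
  exact ⟨f.mul g, rfl⟩

theorem one : IsLevelOne 0 1 := ⟨1, rfl⟩

theorem pow (hf : IsLevelOne k f) (n : ℕ) : IsLevelOne (n * k) (f ^ n) := by
  induction n with
  | zero => simpa using! one
  | succ n ih =>
    rw [pow_succ, show ((n + 1 : ℕ) : ℤ) * k = n * k + k by push_cast; ring]
    exact ih.mul hf

theorem hasQExp (g : ModularForm 𝒮ℒ k) : HasQExp 1 g (qExpansion 1 g) :=
  fun τ ↦ ModularForm.hasSum_qExpansion g one_pos one_mem_strictPeriods_SL τ

theorem exists_hasQExp (hf : IsLevelOne k f) : ∃ c, HasQExp 1 f c := by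
  obtain ⟨f, rfl⟩ := hf
  exact ⟨_, hasQExp f⟩

theorem eq_zero {k : ℕ} (hk : k < 12) (hf : IsLevelOne k f) (hc : HasQExp 1 f c)
    (h₀ : PowerSeries.constantCoeff c = 0) : f = 0 := by
  obtain ⟨f, rfl⟩ := hf
  rw [hc.unique one_pos (hasQExp f)] at h₀
  rw [ModularForm.sturm_bound_levelOne_nat (f := f)]
  · rfl
  · rw [Nat.div_eq_of_lt hk]
    refine lt_of_lt_of_le ?_ (PowerSeries.le_order _ 1 fun i hi ↦ ?_)
    · simp
    · have : i = 0 := by simpa using hi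
      subst this
      simpa using h₀

theorem exists_eq_discriminant_mul (hf : IsLevelOne (k + 12) f) (hc : HasQExp 1 f c)
    (h₀ : PowerSeries.constantCoeff c = 0) :
    ∃ g, IsLevelOne k g ∧ f = ModularForm.discriminant * g := by
  obtain ⟨f, rfl⟩ := hf
  rw [hc.unique one_pos (hasQExp f)] at h₀
  let F := ModularForm.toCuspForm f (by simpa using h₀)
  refine ⟨CuspForm.discriminantEquiv F, ?_,
    (ModularForm.discriminant_mul_discriminantEquiv F).symm⟩
  have key {l : ℤ} (hl : l = k) (g : ModularForm 𝒮ℒ l) : IsLevelOne k g := hl ▸ ⟨g, rfl⟩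
  exact key (by ring) _

end IsLevelOne

end

section

open UpperHalfPlane hiding I
open Complex Function ModularGroup Derivative EisensteinSeries ModularForm
open scoped Manifold PowerSeries Topology ModularForm MatrixGroups CongruenceSubgroup
open scoped ArithmeticFunction.sigma

theorem HasQExp.apply_T {f : ℍ → ℂ} {c : ℂ⟦X⟧} (hf : HasQExp 1 f c) (τ : ℍ) :
    f (T • τ) = f τ := by
  refine (hf (T • τ)).unique (hasSum_of_eq (hf τ) fun m ↦ ?_)
  have h : ((T • τ : ℍ) : ℂ) = τ + 1 := by simpa using coe_T_zpow_smul_eq (z := τ) (n := 1)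
  rw [h]
  have : Periodic.qParam 1 (τ + 1) = Periodic.qParam 1 τ := by
    simp only [Periodic.qParam, ofReal_one, div_one, mul_add, mul_one, exp_add, exp_two_pi_mul_I]
  rw [this]

theorem slash_S_eq_iff {k : ℤ} {f : ℍ → ℂ} :
    f ∣[k] S = f ↔ ∀ τ : ℍ, f (S • τ) = (τ : ℂ) ^ k * f τ := by
  refine funext_iff.trans (forall_congr' fun τ ↦ ?_)
  have := zpow_ne_zero k (UpperHalfPlane.ne_zero τ)
  rw [ModularForm.SL_slash_apply, ModularGroup.denom_S, zpow_neg]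
  field_simp

theorem IsLevelOne.mdifferentiable {k : ℤ} {f : ℍ → ℂ} (hf : IsLevelOne k f) : MDiff f := by
  obtain ⟨g, rfl⟩ := hf
  exact g.holo'

/-- The expansion of the Eisenstein series of weight two, with integral coefficients. -/
noncomputable def qE₂ : ℤ⟦X⟧ := .mk fun m ↦ if m = 0 then 1 else -24 * (σ 1 m : ℤ)

/-- The expansion of the Eisenstein series of weight four, with integral coefficients. -/
noncomputable def qE₄ : ℤ⟦X⟧ := .mk fun m ↦ if m = 0 then 1 else 240 * (σ 3 m : ℤ)

/-- The expansion of the Eisenstein series of weight six, with integral coefficients. -/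
noncomputable def qE₆ : ℤ⟦X⟧ := .mk fun m ↦ if m = 0 then 1 else -504 * (σ 5 m : ℤ)

theorem hasQExp_E2 : HasQExp 1 E2 (qE₂.map (Int.castRingHom ℂ)) := fun τ ↦ by
  have := hasSum_qExpansion_E2 (z := τ)
  simp only [Periodic.qParam, ofReal_one, div_one]
  refine hasSum_of_eq this fun m ↦ ?_
  rw [PowerSeries.coeff_map, qE₂, PowerSeries.coeff_mk]
  congr 1
  split_ifs <;> simp

theorem hasQExp_E₄ : HasQExp 1 E₄ (qE₄.map (Int.castRingHom ℂ)) := by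
  convert IsLevelOne.hasQExp E₄ using 1
  ext m
  rw [E_qExpansion_coeff _ ⟨2, rfl⟩, PowerSeries.coeff_map, qE₄, PowerSeries.coeff_mk,
    show bernoulli 4 = -1 / 30 by decide +kernel]
  split_ifs <;> norm_num

theorem hasQExp_E₆ : HasQExp 1 E₆ (qE₆.map (Int.castRingHom ℂ)) := by
  convert IsLevelOne.hasQExp E₆ using 1
  ext m
  rw [E_qExpansion_coeff _ ⟨3, rfl⟩, PowerSeries.coeff_map, qE₆, PowerSeries.coeff_mk,
    show bernoulli 6 = 1 / 42 by decide +kernel]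
  split_ifs <;> norm_num

theorem E2_slash_S : E2 ∣[(2 : ℤ)] S =
    E2 + fun τ : ℍ ↦ 12 * (2 * Real.pi * I)⁻¹ * (τ : ℂ)⁻¹ := by
  rw [E2_slash_action]
  ext τ
  have h : (Real.pi : ℂ) ≠ 0 := by exact_mod_cast Real.pi_ne_zero
  have hτ := UpperHalfPlane.ne_zero τ
  simp only [Pi.sub_apply, Pi.smul_apply, Pi.add_apply, D2, ModularGroup.denom_S, riemannZeta_two,
    smul_eq_mul]
  have : ((S : SL(2, ℤ)) 1 0 : ℂ) = 1 := by simp [S]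
  rw [this]
  field_simp
  linear_combination -12 * I_sq

theorem mdifferentiable_inv_coe (a : ℂ) : MDiff (fun τ : ℍ ↦ a * (τ : ℂ)⁻¹) := by
  rw [UpperHalfPlane.mdifferentiable_iff]
  have : DifferentiableOn ℂ (fun z : ℂ ↦ a * z⁻¹) {z | 0 < z.im} := fun z hz ↦ by
    have : z ≠ 0 := by rintro rfl; simp at hz
    exact ((differentiableAt_inv this).const_mul a).differentiableWithinAt
  refine this.congr fun z hz ↦ ?_
  simp [ofComplex_apply_of_im_pos hz]

theorem normalizedDeriv_inv_coe (a : ℂ) : normalizedDerivOfComplex (fun τ : ℍ ↦ a * (τ : ℂ)⁻¹) =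
    fun τ : ℍ ↦ - (2 * Real.pi * I)⁻¹ * a * ((τ : ℂ)⁻¹) ^ 2 := by
  ext τ
  have : (fun τ : ℍ ↦ a * (τ : ℂ)⁻¹) ∘ ofComplex =ᶠ[𝓝 (τ : ℂ)] fun z ↦ a * z⁻¹ := by
    filter_upwards [(HasQExp.isOpen_lt_im 0).mem_nhds (show 0 < (τ : ℂ).im from τ.im_pos)] with z hz
    simp [ofComplex_apply_of_im_pos hz]
  rw [normalizedDerivOfComplex, this.deriv_eq,
    ((hasDerivAt_inv (UpperHalfPlane.ne_zero τ)).const_mul a).deriv]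
  ring

theorem isLevelOne_serreDerivative_E2 :
    IsLevelOne 4 (normalizedDerivOfComplex E2 - fun τ ↦ 12⁻¹ * (E2 * E2) τ) := by
  have hq := hasQExp_E2.normalizedDeriv.sub ((hasQExp_E2.mul hasQExp_E2).const_mul 12⁻¹)
  refine IsLevelOne.of_hasQExp one_pos hq hq.apply_T (slash_S_eq_iff.1 ?_)
  have h1 := normalizedDerivOfComplex_SL_slash (k := 2) E2_mdifferentiable (γ := S)
  have hm := mdifferentiable_inv_coe (12 * (2 * Real.pi * I)⁻¹)
  rw [E2_slash_S, normalizedDerivOfComplex_add _ _ E2_mdifferentiable hm,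
    normalizedDeriv_inv_coe] at h1
  ext τ
  have h2 := congrFun h1 τ
  have h3 := congrFun E2_slash_S τ
  have : ((S : SL(2, ℤ)) 1 0 : ℂ) = 1 := by simp [S]
  simp only [Pi.sub_apply, Pi.add_apply, ModularForm.SL_slash_apply, ModularGroup.denom_S, this,
    Pi.mul_apply, Int.reduceAdd, Int.cast_ofNat] at h2 h3 ⊢
  have hτ := UpperHalfPlane.ne_zero τ
  rw [show (-4 : ℤ) = -2 + -2 by norm_num, zpow_add₀ hτ] at h2 ⊢
  generalize (τ : ℂ) ^ (-2 : ℤ) = t at *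
  generalize (2 * Real.pi * I : ℂ)⁻¹ = c at *
  generalize normalizedDerivOfComplex E2 (S • τ) = x at *
  generalize E2 (S • τ) = y at *
  rw [one_div] at h2
  linear_combination -h2 - 12⁻¹ * (y * t + E2 τ + 12 * c * (τ : ℂ)⁻¹) * h3

theorem IsLevelOne.serreDerivative {k : ℤ} {f : ℍ → ℂ} (hf : IsLevelOne k f) :
    IsLevelOne (k + 2) (normalizedDerivOfComplex f - fun τ ↦ k * 12⁻¹ * (E2 * f) τ) := by
  obtain ⟨c, hc⟩ := hf.exists_hasQExp
  have hq := hc.normalizedDeriv.sub ((hasQExp_E2.mul hc).const_mul (k * 12⁻¹))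
  have := serreDerivative_slash_invariant hf.mdifferentiable (slash_S_eq_iff.2 hf.apply_S)
  have e : (normalizedDerivOfComplex f - fun τ ↦ k * 12⁻¹ * (E2 * f) τ) =
      Derivative.serreDerivative k f := by
    ext τ
    simp
    ring
  exact IsLevelOne.of_hasQExp one_pos hq hq.apply_T (slash_S_eq_iff.1 (e ▸ this))

theorem PowerSeries.map_derivative {R A : Type*} [CommSemiring R] [CommSemiring A] (f : R →+* A)
    (c : R⟦X⟧) : (PowerSeries.derivative R c).map f = PowerSeries.derivative A (c.map f) := by
  ext n
  simp [PowerSeries.coeff_derivative]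

theorem PowerSeries.coeff_ofNat_mul {R : Type*} [CommSemiring R] (n m : ℕ) [n.AtLeastTwo]
    (c : R⟦X⟧) : coeff m ((ofNat(n) : R⟦X⟧) * c) = ofNat(n) * coeff m c := by
  rw [← map_ofNat (PowerSeries.C (R := R)) n, coeff_C_mul]

theorem PowerSeries.constantCoeff_map_apply {R S : Type*} [CommSemiring R] [CommSemiring S]
    (f : R →+* S) (c : R⟦X⟧) : constantCoeff (c.map f) = f (constantCoeff c) := by
  simp only [← coeff_zero_eq_constantCoeff_apply, coeff_map]

theorem constantCoeff_qE₂ : PowerSeries.constantCoeff qE₂ = 1 := by simp [qE₂]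

theorem constantCoeff_qE₄ : PowerSeries.constantCoeff qE₄ = 1 := by simp [qE₄]

theorem constantCoeff_qE₆ : PowerSeries.constantCoeff qE₆ = 1 := by simp [qE₆]

theorem qE₂_ramanujan : 12 * (PowerSeries.X * d⁄dX ℤ qE₂) = qE₂ ^ 2 - qE₄ := by
  have hq := (hasQExp_E2.normalizedDeriv.sub ((hasQExp_E2.mul hasQExp_E2).const_mul 12⁻¹)).add
    (hasQExp_E₄.const_mul 12⁻¹)
  have h0 := (isLevelOne_serreDerivative_E2.add (.const_mul ⟨E₄, rfl⟩ 12⁻¹)).eq_zero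
    (k := 4) (by norm_num) hq (by
      norm_num [PowerSeries.constantCoeff_map_apply, constantCoeff_qE₂, constantCoeff_qE₄,
        constantCoeff_qE₆])
  rw [h0] at hq
  have := hq.unique one_pos (fun τ ↦ by simp : HasQExp 1 0 0)
  apply PowerSeries.map_injective (Int.castRingHom ℂ) Int.cast_injective
  have h12 : (PowerSeries.C 12⁻¹ : ℂ⟦X⟧) * 12 = 1 := by
    rw [← map_ofNat (PowerSeries.C (R := ℂ)) 12, ← map_mul]
    norm_num
  simp only [map_mul, map_sub, map_pow, map_ofNat, PowerSeries.map_derivative, PowerSeries.map_X]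
  linear_combination 12 * this +
    ((qE₂.map (Int.castRingHom ℂ)) ^ 2 - qE₄.map (Int.castRingHom ℂ)) * h12

theorem qE₄_ramanujan : 3 * (PowerSeries.X * d⁄dX ℤ qE₄) = qE₂ * qE₄ - qE₆ := by
  have hq := (hasQExp_E₄.normalizedDeriv.sub ((hasQExp_E2.mul hasQExp_E₄).const_mul
    ((4 : ℤ) * 12⁻¹))).add (hasQExp_E₆.const_mul 3⁻¹)
  have h0 := ((IsLevelOne.serreDerivative ⟨E₄, rfl⟩).add (.const_mul ⟨E₆, rfl⟩ 3⁻¹)).eq_zero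
    (k := 6) (by norm_num) hq (by
      norm_num [PowerSeries.constantCoeff_map_apply, constantCoeff_qE₂, constantCoeff_qE₄,
        constantCoeff_qE₆])
  rw [h0] at hq
  have := hq.unique one_pos (fun τ ↦ by simp : HasQExp 1 0 0)
  apply PowerSeries.map_injective (Int.castRingHom ℂ) Int.cast_injective
  have h3 : (PowerSeries.C 3⁻¹ : ℂ⟦X⟧) * 3 = 1 := by
    rw [← map_ofNat (PowerSeries.C (R := ℂ)) 3, ← map_mul]
    norm_num
  rw [show ((4 : ℤ) * 12⁻¹ : ℂ) = 3⁻¹ by norm_num] at this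
  simp only [map_mul, map_sub, map_ofNat, PowerSeries.map_derivative, PowerSeries.map_X]
  linear_combination 3 * this + ((qE₂.map (Int.castRingHom ℂ)) * qE₄.map (Int.castRingHom ℂ) -
    qE₆.map (Int.castRingHom ℂ)) * h3

theorem qE₆_ramanujan : 2 * (PowerSeries.X * d⁄dX ℤ qE₆) = qE₂ * qE₆ - qE₄ ^ 2 := by
  have hq := (hasQExp_E₆.normalizedDeriv.sub ((hasQExp_E2.mul hasQExp_E₆).const_mul
    ((6 : ℤ) * 12⁻¹))).add ((hasQExp_E₄.mul hasQExp_E₄).const_mul 2⁻¹)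
  have h0 := ((IsLevelOne.serreDerivative ⟨E₆, rfl⟩).add
    (.const_mul (.mul ⟨E₄, rfl⟩ ⟨E₄, rfl⟩) 2⁻¹)).eq_zero
    (k := 8) (by norm_num) hq (by
      norm_num [PowerSeries.constantCoeff_map_apply, constantCoeff_qE₂, constantCoeff_qE₄,
        constantCoeff_qE₆])
  rw [h0] at hq
  have := hq.unique one_pos (fun τ ↦ by simp : HasQExp 1 0 0)
  apply PowerSeries.map_injective (Int.castRingHom ℂ) Int.cast_injective
  have h2 : (PowerSeries.C 2⁻¹ : ℂ⟦X⟧) * 2 = 1 := by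
    rw [← map_ofNat (PowerSeries.C (R := ℂ)) 2, ← map_mul]
    norm_num
  rw [show ((6 : ℤ) * 12⁻¹ : ℂ) = 2⁻¹ by norm_num] at this
  simp only [map_mul, map_sub, map_pow, map_ofNat, PowerSeries.map_derivative, PowerSeries.map_X]
  linear_combination 2 * this + ((qE₂.map (Int.castRingHom ℂ)) * qE₆.map (Int.castRingHom ℂ) -
    qE₄.map (Int.castRingHom ℂ) ^ 2) * h2

/-- The expansion of the modular discriminant, with integral coefficients. -/
noncomputable def qΔ : ℤ⟦X⟧ :=
  .mk (fun m ↦ (5 * (σ 3 m : ℤ) + 7 * (σ 5 m : ℤ)) / 12) + 100 * .mk (fun m ↦ (σ 3 m : ℤ)) ^ 2 +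
    8000 * .mk (fun m ↦ (σ 3 m : ℤ)) ^ 3 - 147 * .mk (fun m ↦ (σ 5 m : ℤ)) ^ 2

theorem qΔ_eq : 1728 * qΔ = qE₄ ^ 3 - qE₆ ^ 2 := by
  have h₄ : qE₄ = 1 + 240 * .mk fun m ↦ (σ 3 m : ℤ) := by
    ext m
    by_cases hm : m = 0 <;> simp [qE₄, hm, PowerSeries.coeff_one, PowerSeries.coeff_ofNat_mul]
  have h₆ : qE₆ = 1 - 504 * .mk fun m ↦ (σ 5 m : ℤ) := by
    ext m
    by_cases hm : m = 0 <;> simp [qE₆, hm, PowerSeries.coeff_one, PowerSeries.coeff_ofNat_mul]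
  have h : 12 * (.mk fun m ↦ (5 * (σ 3 m : ℤ) + 7 * (σ 5 m : ℤ)) / 12 : ℤ⟦X⟧) =
      5 * (.mk fun m ↦ (σ 3 m : ℤ)) + 7 * .mk fun m ↦ (σ 5 m : ℤ) := by
    ext m
    simp only [map_add, PowerSeries.coeff_ofNat_mul, PowerSeries.coeff_mk]
    refine Int.mul_ediv_cancel' ?_
    simp only [ArithmeticFunction.sigma_apply, Nat.cast_sum, Finset.mul_sum,
      ← Finset.sum_add_distrib]
    refine Finset.dvd_sum fun d _ ↦ ?_
    push_cast
    rw [show (12 : ℤ) = (12 : ℕ) by rfl, ← ZMod.intCast_zmod_eq_zero_iff_dvd]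
    push_cast
    generalize (d : ZMod 12) = x
    decide +revert
  rw [h₄, h₆, qΔ]
  linear_combination 144 * h

theorem constantCoeff_qΔ : PowerSeries.constantCoeff qΔ = 0 := by simp [qΔ]

theorem coeff_one_qΔ : PowerSeries.coeff 1 qΔ = 1 := by
  simp [qΔ, pow_succ, PowerSeries.coeff_ofNat_mul, PowerSeries.coeff_one_mul, mul_assoc]

theorem hasQExp_discriminant :
    HasQExp 1 ModularForm.discriminant (qΔ.map (Int.castRingHom ℂ)) := by
  convert ((hasQExp_E₄.pow 3).sub (hasQExp_E₆.pow 2)).const_mul 1728⁻¹ using 1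
  · ext τ
    rw [ModularForm.discriminant_eq_E₄_cube_sub_E₆_sq]
    simp [div_eq_inv_mul]
  · rw [← map_pow, ← map_pow, ← map_sub, ← qΔ_eq, map_mul, ← mul_assoc]
    rw [map_ofNat, ← map_ofNat (PowerSeries.C (R := ℂ)) 1728, ← map_mul]
    norm_num

end

section

open UpperHalfPlane hiding I
open Complex Function ModularGroup
open scoped PowerSeries MatrixGroups

namespace HasQExp

theorem congr_fun {h : ℝ} {f g : ℍ → ℂ} {c : ℂ⟦X⟧} (hf : HasQExp h f c) (hg : HasQExp h g c) :
    f = g :=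
  funext fun τ ↦ (hf τ).unique (hg τ)

theorem expand {h h' : ℝ} {f : ℍ → ℂ} {c : ℂ⟦X⟧} (hf : HasQExp h f c) {g : ℍ → ℍ} {n : ℕ}
    (hn : n ≠ 0) (hg : ∀ τ : ℍ, Periodic.qParam h' τ ^ n = Periodic.qParam h (g τ)) :
    HasQExp h' (fun τ ↦ f (g τ)) (c.expand n hn) := by
  intro τ
  refine (Injective.hasSum_iff (mul_right_injective₀ hn) fun m hm ↦ ?_).1 ?_
  · rw [PowerSeries.coeff_expand, if_neg, zero_smul]
    rintro ⟨m, rfl⟩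
    exact hm ⟨m, rfl⟩
  · refine hasSum_of_eq (hf (g τ)) fun m ↦ ?_
    simp only [Function.comp, PowerSeries.coeff_expand_mul, pow_mul, hg]

theorem rescale {h h' : ℝ} {f : ℍ → ℂ} {c : ℂ⟦X⟧} (hf : HasQExp h f c) {g : ℍ → ℍ} {a : ℂ}
    (hg : ∀ τ : ℍ, a * Periodic.qParam h' τ = Periodic.qParam h (g τ)) :
    HasQExp h' (fun τ ↦ f (g τ)) (PowerSeries.rescale a c) := by
  intro τ
  refine hasSum_of_eq (hf (g τ)) fun m ↦ ?_
  simp only [PowerSeries.coeff_rescale, ← hg, mul_pow, smul_eq_mul]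
  ring

end HasQExp

theorem IsLevelOne.apply_of_mul_eq {k : ℤ} {f : ℍ → ℂ} (hf : IsLevelOne k f) {a b c d : ℤ}
    (hdet : a * d - b * c = 1) {τ τ' : ℍ} (h : (τ' : ℂ) * (c * τ + d) = a * τ + b) :
    f τ' = (c * τ + d : ℂ) ^ k * f τ := by
  let γ : SL(2, ℤ) := ⟨!![a, b; c, d], by rw [Matrix.det_fin_two_of]; exact hdet⟩
  have hγ : γ • τ = τ' := by
    ext
    rw [UpperHalfPlane.coe_specialLinearGroup_apply]
    have hd : (c * τ + d : ℂ) ≠ 0 := by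
      have := UpperHalfPlane.denom_ne_zero γ τ
      rw [ModularGroup.denom_apply] at this
      simpa [γ] using this
    simp only [γ, Matrix.of_apply, Matrix.cons_val', Matrix.cons_val_zero, Matrix.cons_val_one,
      Matrix.cons_val_fin_one, algebraMap_int_eq, eq_intCast, ofReal_intCast]
    rw [← h, mul_div_cancel_right₀ _ hd]
  rw [← hγ, hf.apply_smul]
  simp [γ]

/-- The point `n * τ` of the upper half plane. -/
noncomputable def mulPoint (n : ℕ) [NeZero n] (τ : ℍ) : ℍ :=
  ⟨n * τ, by
    have := NeZero.pos n
    simpa using mul_pos (Nat.cast_pos.2 this) τ.im_pos⟩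

/-- The point `(τ + k) / n` of the upper half plane. -/
noncomputable def divPoint (n : ℕ) [NeZero n] (k : ℤ) (τ : ℍ) : ℍ :=
  ⟨(τ + k) / n, by
    have := NeZero.pos n
    simpa using div_pos τ.im_pos (Nat.cast_pos.2 this)⟩

theorem coe_mulPoint (n : ℕ) [NeZero n] (τ : ℍ) : (mulPoint n τ : ℂ) = n * τ := rfl

theorem coe_divPoint (n : ℕ) [NeZero n] (k : ℤ) (τ : ℍ) : (divPoint n k τ : ℂ) = (τ + k) / n := rfl

section Expansions

variable {f : ℍ → ℂ} {c : ℂ⟦X⟧} (hf : HasQExp 1 f c) (n : ℕ) [NeZero n]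
include hf

theorem HasQExp.expand_self : HasQExp n f (c.expand n (NeZero.ne n)) := by
  refine hf.expand (g := id) (NeZero.ne n) fun τ ↦ ?_
  have : (n : ℂ) ≠ 0 := Nat.cast_ne_zero.2 (NeZero.ne n)
  simp only [Periodic.qParam, ← exp_nat_mul, id]
  congr 1
  push_cast
  field_simp

theorem HasQExp.comp_mulPoint :
    HasQExp n (fun τ ↦ f (mulPoint n τ))
      (c.expand (n * n) (mul_ne_zero (NeZero.ne n) (NeZero.ne n))) := by
  refine hf.expand _ fun τ ↦ ?_
  have : (n : ℂ) ≠ 0 := Nat.cast_ne_zero.2 (NeZero.ne n)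
  simp only [Periodic.qParam, ← exp_nat_mul, coe_mulPoint]
  congr 1
  push_cast
  field_simp

theorem HasQExp.comp_divPoint (k : ℕ) :
    HasQExp n (fun τ ↦ f (divPoint n k τ))
      (PowerSeries.rescale (exp (2 * Real.pi * I / n) ^ k) c) := by
  refine hf.rescale fun τ ↦ ?_
  have : (n : ℂ) ≠ 0 := Nat.cast_ne_zero.2 (NeZero.ne n)
  simp only [Periodic.qParam, ← exp_nat_mul, coe_divPoint, ← exp_add]
  congr 1
  push_cast
  field_simp
  ring

end Expansions

section Hecke

variable (p : ℕ) [Fact p.Prime]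

/-- The translates of a modular form of weight `w` by the cosets of matrices of determinant `p`. -/
noncomputable def heckeFamily (w : ℕ) (f : ℍ → ℂ) : Option (ZMod p) → ℍ → ℂ
  | none => fun τ ↦ p ^ w * f (mulPoint p τ)
  | some k => fun τ ↦ f (divPoint p k.val τ)

/-- The permutation of the cosets of matrices of determinant `p` induced by translation. -/
def permT : Equiv.Perm (Option (ZMod p)) := Equiv.optionCongr (Equiv.addRight 1)

/-- The action of the inversion on the cosets of matrices of determinant `p`. -/
def mapS : Option (ZMod p) → Option (ZMod p)
  | none => some 0
  | some k => if k = 0 then none else some (-k⁻¹)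

theorem mapS_involutive : Involutive (mapS p)
  | none => by simp [mapS]
  | some k => by by_cases hk : k = 0 <;> simp [mapS, hk, inv_neg]

/-- The permutation of the cosets of matrices of determinant `p` induced by the inversion. -/
def permS : Equiv.Perm (Option (ZMod p)) := (mapS_involutive p).toPerm

variable {p} {w : ℕ} {f : ℍ → ℂ} (hf : IsLevelOne w f)
include hf

theorem heckeFamily_T (γ : Option (ZMod p)) (τ : ℍ) :
    heckeFamily p w f γ (T • τ) = heckeFamily p w f (permT p γ) τ := by
  have hT : ((T • τ : ℍ) : ℂ) = τ + 1 := by simpa using coe_T_zpow_smul_eq (z := τ) (n := 1)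
  have hp : (p : ℂ) ≠ 0 := Nat.cast_ne_zero.2 (NeZero.ne p)
  rcases γ with _ | k
  · have := hf.apply_of_mul_eq (a := 1) (b := p) (c := 0) (d := 1) (by simp) (τ := mulPoint p τ)
      (τ' := mulPoint p (T • τ)) (by
        simp only [coe_mulPoint, hT]
        push_cast
        ring)
    simp only [heckeFamily, permT, Equiv.optionCongr_apply, Option.map_none, this]
    simp
  · obtain ⟨b, hb⟩ : (p : ℤ) ∣ k.val + 1 - (k + 1).val := by
      rw [← ZMod.intCast_zmod_eq_zero_iff_dvd]
      simp
    have hb' : (k.val + 1 - (k + 1).val : ℂ) = p * b := mod_cast congrArg (Int.cast (R := ℂ)) hb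
    have := hf.apply_of_mul_eq (a := 1) (b := b) (c := 0) (d := 1) (by simp)
      (τ := divPoint p (k + 1).val τ) (τ' := divPoint p k.val (T • τ)) (by
        simp only [coe_divPoint, hT]
        push_cast
        field_simp
        linear_combination p * hb')
    simp only [heckeFamily, permT, Equiv.optionCongr_apply, Option.map_some, this]
    simp

theorem heckeFamily_S (γ : Option (ZMod p)) (τ : ℍ) :
    heckeFamily p w f γ (S • τ) = τ ^ w * heckeFamily p w f (permS p γ) τ := by
  have hS : ((S • τ : ℍ) : ℂ) = -(τ : ℂ)⁻¹ := by
    rw [modular_S_smul]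
    simp [inv_neg]
  have hp : (p : ℂ) ≠ 0 := Nat.cast_ne_zero.2 (NeZero.ne p)
  have hτ : (τ : ℂ) ≠ 0 := UpperHalfPlane.ne_zero τ
  rcases γ with _ | k
  · have := hf.apply_of_mul_eq (a := 0) (b := -1) (c := 1) (d := 0) (by simp)
      (τ := divPoint p (0 : ZMod p).val τ) (τ' := mulPoint p (S • τ)) (by
        simp only [coe_divPoint, coe_mulPoint, hS]
        simp
        field_simp)
    simp only [heckeFamily, permS, Involutive.coe_toPerm, mapS, this, coe_divPoint]
    simp
    rw [div_pow]
    field_simp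
  · by_cases hk : k = 0
    · subst hk
      have := hf.apply_of_mul_eq (a := 0) (b := -1) (c := 1) (d := 0) (by simp)
        (τ := mulPoint p τ) (τ' := divPoint p (0 : ZMod p).val (S • τ)) (by
          simp only [coe_divPoint, coe_mulPoint, hS]
          simp
          field_simp)
      simp only [heckeFamily, permS, Involutive.coe_toPerm, mapS, this, coe_mulPoint]
      simp
      ring
    · obtain ⟨b, hb⟩ : (p : ℤ) ∣ -1 - k.val * (-k⁻¹).val := by
        rw [← ZMod.intCast_zmod_eq_zero_iff_dvd]
        simp [hk]
      have hb' : (-1 - k.val * (-k⁻¹).val : ℂ) = p * b :=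
        mod_cast congrArg (Int.cast (R := ℂ)) hb
      simp only [heckeFamily, permS, Involutive.coe_toPerm, mapS, if_neg hk]
      generalize (-k⁻¹).val = k' at *
      have := hf.apply_of_mul_eq (a := k.val) (b := b) (c := p) (d := -k')
        (by linear_combination hb)
        (τ := divPoint p k' τ) (τ' := divPoint p k.val (S • τ)) (by
          simp only [coe_divPoint, hS]
          push_cast
          field_simp
          linear_combination τ * hb')
      rw [this, coe_divPoint]
      push_cast
      field_simp
      simp [mul_comm]

end Hecke

theorem IsLevelOne.prod {ι : Type*} [Fintype ι] {w : ℕ} {φ : ι → ℍ → ℂ} {σT σS : Equiv.Perm ι}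
    (hT : ∀ γ τ, φ γ (T • τ) = φ (σT γ) τ) (hS : ∀ γ (τ : ℍ), φ γ (S • τ) = τ ^ w * φ (σS γ) τ)
    {h : ℝ} (hh : 0 < h) {c : ℂ⟦X⟧} (hc : HasQExp h (fun τ ↦ ∏ γ, φ γ τ) c) :
    IsLevelOne (w * Fintype.card ι) fun τ ↦ ∏ γ, φ γ τ := by
  refine .of_hasQExp hh hc (fun τ ↦ ?_) fun τ ↦ ?_
  · simp only [hT]
    exact Equiv.prod_comp σT fun γ ↦ φ γ τ
  · simp only [hS, Finset.prod_mul_distrib, Finset.prod_const, Finset.card_univ]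
    rw [Equiv.prod_comp σS fun γ ↦ φ γ τ, ← pow_mul]
    norm_cast

end

section

open UpperHalfPlane hiding I
open Complex Function
open scoped PowerSeries

/-- The expansion of the cube of the Eisenstein series of weight four. -/
noncomputable def qE₄Cube (R : Type*) [CommRing R] : R⟦X⟧ := qE₄.map (Int.castRingHom R) ^ 3

/-- The expansion of the modular discriminant, with coefficients in an arbitrary ring. -/
noncomputable def qDisc (R : Type*) [CommRing R] : R⟦X⟧ := qΔ.map (Int.castRingHom R)

section QExpansions

variable {R S : Type*} [CommRing R] [CommRing S]

theorem map_qE₄Cube (f : R →+* S) : (qE₄Cube R).map f = qE₄Cube S := by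
  rw [qE₄Cube, qE₄Cube, map_pow, ← RingHom.comp_apply, ← PowerSeries.map_comp,
    RingHom.ext_int (f.comp (Int.castRingHom R)) (Int.castRingHom S)]

theorem map_qDisc (f : R →+* S) : (qDisc R).map f = qDisc S := by
  rw [qDisc, qDisc, ← RingHom.comp_apply, ← PowerSeries.map_comp,
    RingHom.ext_int (f.comp (Int.castRingHom R)) (Int.castRingHom S)]

theorem constantCoeff_qE₄Cube : PowerSeries.constantCoeff (qE₄Cube R) = 1 := by
  simp [qE₄Cube, PowerSeries.constantCoeff_map_apply, constantCoeff_qE₄]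

theorem constantCoeff_qDisc : PowerSeries.constantCoeff (qDisc R) = 0 := by
  simp [qDisc, PowerSeries.constantCoeff_map_apply, constantCoeff_qΔ]

theorem coeff_one_qDisc : PowerSeries.coeff 1 (qDisc R) = 1 := by
  simp [qDisc, coeff_one_qΔ]

theorem exists_qDisc_mul_eq_X : ∃ V : R⟦X⟧, qDisc R * V = PowerSeries.X := by
  obtain ⟨U, hU⟩ := PowerSeries.X_dvd_iff.2 (constantCoeff_qDisc (R := R))
  have h := coeff_one_qDisc (R := R)
  rw [hU, ← zero_add 1, PowerSeries.coeff_succ_X_mul,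
    PowerSeries.coeff_zero_eq_constantCoeff_apply] at h
  obtain ⟨V, hV⟩ := (PowerSeries.isUnit_iff_constantCoeff.2 (h ▸ isUnit_one)).exists_right_inv
  exact ⟨V, by rw [hU, mul_assoc, hV, mul_one]⟩

theorem qDisc_ne_zero [Nontrivial R] : qDisc R ≠ 0 := fun h ↦ by
  have := coeff_one_qDisc (R := R)
  simp [h] at this

end QExpansions

/-- The cube of the Eisenstein series of weight four. -/
noncomputable def E₄Cube : ℍ → ℂ := ⇑ModularForm.E₄ ^ 3

theorem hasQExp_E₄Cube : HasQExp 1 E₄Cube (qE₄Cube ℂ) :=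
  hasQExp_E₄.pow 3

theorem isLevelOne_E₄Cube : IsLevelOne (12 : ℕ) E₄Cube :=
  IsLevelOne.pow ⟨ModularForm.E₄, rfl⟩ 3

theorem isLevelOne_discriminant : IsLevelOne (12 : ℕ) ModularForm.discriminant :=
  .of_hasQExp one_pos hasQExp_discriminant hasQExp_discriminant.apply_T
    (slash_S_eq_iff.1 ModularForm.discriminant_S_invariant)

theorem hasQExp_sum {O : Type*} [CommRing O] (ι : O →+* ℂ) (n : ℕ) (h : ℕ → O) :
    HasQExp 1 (fun τ ↦ ∑ i ∈ Finset.range (n + 1),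
        ι (h i) * E₄Cube τ ^ i * ModularForm.discriminant τ ^ (n - i))
      ((∑ i ∈ Finset.range (n + 1), PowerSeries.C (h i) * qE₄Cube O ^ i *
        qDisc O ^ (n - i)).map ι) := by
  simp only [map_sum, map_mul, map_pow, map_qE₄Cube, map_qDisc, PowerSeries.map_C]
  convert HasQExp.sum (Finset.range (n + 1)) fun i _ ↦
    ((hasQExp_E₄Cube.pow i).const_mul (ι (h i))).mul (hasQExp_discriminant.pow (n - i)) using 1
  · ext τ
    simp
  · rfl

theorem IsLevelOne.exists_eq_sum {O : Type*} [CommRing O] {ι : O →+* ℂ} (hι : Injective ι) (n : ℕ)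
    {f : ℍ → ℂ} {c : O⟦X⟧} (hf : IsLevelOne (12 * n : ℕ) f) (hc : HasQExp 1 f (c.map ι)) :
    ∃ h : ℕ → O, c = ∑ i ∈ Finset.range (n + 1),
      PowerSeries.C (h i) * qE₄Cube O ^ i * qDisc O ^ (n - i) := by
  induction n generalizing f c with
  | zero =>
    have hq := hc.sub (HasQExp.const (ι (PowerSeries.constantCoeff c)))
    have h1 : IsLevelOne (12 * 0 : ℕ) fun _ ↦ ι (PowerSeries.constantCoeff c) := by
      simpa using IsLevelOne.one.const_mul (ι (PowerSeries.constantCoeff c))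
    have h0 := (hf.sub h1).eq_zero (by norm_num) hq (by
      simp [PowerSeries.constantCoeff_map_apply])
    rw [h0] at hq
    have := hq.unique one_pos (fun τ ↦ by simp : HasQExp 1 0 0)
    refine ⟨fun _ ↦ PowerSeries.constantCoeff c, PowerSeries.map_injective ι hι ?_⟩
    simpa using sub_eq_zero.1 this
  | succ n ih =>
    set c₀ := PowerSeries.constantCoeff c with hc₀
    have hq := hc.sub ((hasQExp_E₄Cube.pow (n + 1)).const_mul (ι c₀))
    have hS : IsLevelOne (12 * n + 12 : ℤ) fun τ ↦ ι c₀ * (E₄Cube ^ (n + 1)) τ := by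
      convert (isLevelOne_E₄Cube.pow (n + 1)).const_mul (ι c₀) using 1
      push_cast
      ring
    obtain ⟨g, hg, hfg⟩ :=
      (IsLevelOne.sub (by convert hf using 1; push_cast; ring) hS).exists_eq_discriminant_mul
      hq (by
        simp [PowerSeries.constantCoeff_map_apply, constantCoeff_qE₄Cube, hc₀])
    obtain ⟨d, hd⟩ := hg.exists_hasQExp
    rw [hfg] at hq
    have hdq := (hasQExp_discriminant.mul hd).unique one_pos hq
    obtain ⟨e, he⟩ : PowerSeries.X ∣ c - PowerSeries.C c₀ * qE₄Cube O ^ (n + 1) := by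
      rw [PowerSeries.X_dvd_iff]
      simp [constantCoeff_qE₄Cube, hc₀]
    obtain ⟨V, hV⟩ := exists_qDisc_mul_eq_X (R := O)
    have hd' : d = (V * e).map ι := by
      apply mul_left_cancel₀ (qDisc_ne_zero (R := ℂ))
      rw [← map_qDisc ι, ← map_mul, ← mul_assoc, hV, ← he, map_qDisc]
      refine hdq.trans ?_
      simp [map_qE₄Cube]
    rw [hd'] at hd
    obtain ⟨h, hh⟩ := ih (by exact_mod_cast hg) hd
    refine ⟨fun i ↦ if i = n + 1 then c₀ else h i, ?_⟩
    have h1 : c = qDisc O * (V * e) + PowerSeries.C c₀ * qE₄Cube O ^ (n + 1) := by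
      rw [← mul_assoc, hV, ← he, sub_add_cancel]
    beta_reduce
    rw [Finset.sum_range_succ, if_pos rfl, Nat.sub_self, pow_zero, mul_one, h1, hh, Finset.mul_sum]
    congr 1
    refine Finset.sum_congr rfl fun i hi ↦ ?_
    have hi := Finset.mem_range.1 hi
    rw [if_neg hi.ne, Nat.succ_sub (Nat.lt_succ_iff.1 hi), pow_succ]
    ring

end

section

open UpperHalfPlane hiding I
open Complex Function ModularGroup
open scoped PowerSeries

theorem PowerSeries.map_rescale {R S : Type*} [CommSemiring R] [CommSemiring S] (f : R →+* S)
    (a : R) (c : R⟦X⟧) : (rescale a c).map f = rescale (f a) (c.map f) := by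
  ext m
  simp [coeff_rescale]

theorem IsLevelOne.exists_expand_eq {O : Type*} [CommRing O] {ι : O →+* ℂ} (hι : Injective ι)
    {p : ℕ} [NeZero p] {n : ℕ} {f : ℍ → ℂ} {c : O⟦X⟧} (hf : IsLevelOne (12 * n : ℕ) f)
    (hc : HasQExp p f (c.map ι)) :
    ∃ h : ℕ → O, c = PowerSeries.expand p (NeZero.ne p) (∑ i ∈ Finset.range (n + 1),
        PowerSeries.C (h i) * qE₄Cube O ^ i * qDisc O ^ (n - i)) ∧
      ∀ τ, f τ = ∑ i ∈ Finset.range (n + 1),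
        ι (h i) * E₄Cube τ ^ i * ModularForm.discriminant τ ^ (n - i) := by
  obtain ⟨d, hd⟩ := hf.exists_hasQExp
  have hp : (0 : ℝ) < p := Nat.cast_pos.2 (NeZero.pos p)
  have hcd := hc.unique hp (hd.expand_self p)
  have hd' : d = (PowerSeries.mk fun m ↦ PowerSeries.coeff (p * m) c).map ι := by
    ext m
    rw [PowerSeries.coeff_map, PowerSeries.coeff_mk, ← PowerSeries.coeff_map, hcd,
      PowerSeries.coeff_expand_mul]
  rw [hd'] at hd hcd
  rw [← PowerSeries.map_expand] at hcd
  obtain ⟨h, hh⟩ := hf.exists_eq_sum hι n hd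
  refine ⟨h, hh ▸ PowerSeries.map_injective ι hι hcd, fun τ ↦ ?_⟩
  rw [hh] at hd
  exact congrFun (hd.congr_fun (hasQExp_sum ι n h)) τ

theorem exists_coeff_hecke {O : Type*} [CommRing O] {ι : O →+* ℂ} (hι : Injective ι)
    {p : ℕ} [Fact p.Prime] {z : O} (hz : ι z = exp (2 * Real.pi * I / p)) {a b w n : ℕ}
    (habw : a + w + b = 12) (hn : (12 + w) * (p + 1) = 12 * n) {f g : ℍ → ℂ} {c d : O⟦X⟧}
    (hf : IsLevelOne (12 : ℕ) f) (hg : IsLevelOne w g) (hc : HasQExp 1 f (c.map ι))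
    (hd : HasQExp 1 g (d.map ι)) :
    ∃ h : ℕ → O,
      (c.expand p (NeZero.ne p) * d.expand (p * p) (NeZero.ne _) -
        p ^ b * (c.expand (p * p) (NeZero.ne _) * d.expand p (NeZero.ne p))) *
        ∏ k : ZMod p, (p ^ a * (c.expand p (NeZero.ne p) * PowerSeries.rescale (z ^ k.val) d) -
          PowerSeries.rescale (z ^ k.val) c * d.expand p (NeZero.ne p)) =
        PowerSeries.expand p (NeZero.ne p) (∑ i ∈ Finset.range (n + 1),
          PowerSeries.C (h i) * qE₄Cube O ^ i * qDisc O ^ (n - i)) ∧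
      ∀ τ, f τ * g (mulPoint p τ) = p ^ b * (f (mulPoint p τ) * g τ) →
        ∑ i ∈ Finset.range (n + 1),
          ι (h i) * E₄Cube τ ^ i * ModularForm.discriminant τ ^ (n - i) = 0 := by
  let G : ℍ → ℂ := fun τ ↦ (f τ * g (mulPoint p τ) - p ^ b * (f (mulPoint p τ) * g τ)) *
    ∏ k : ZMod p, (p ^ a * (f τ * g (divPoint p k.val τ)) - f (divPoint p k.val τ) * g τ)
  have hp : (0 : ℝ) < p := Nat.cast_pos.2 (NeZero.pos p)
  have hp₀ : (p : ℂ) ≠ 0 := Nat.cast_ne_zero.2 (NeZero.ne p)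
  have hG : HasQExp p G (((c.expand p (NeZero.ne p) * d.expand (p * p) (NeZero.ne _) -
      p ^ b * (c.expand (p * p) (NeZero.ne _) * d.expand p (NeZero.ne p))) *
      ∏ k : ZMod p, (p ^ a * (c.expand p (NeZero.ne p) * PowerSeries.rescale (z ^ k.val) d) -
        PowerSeries.rescale (z ^ k.val) c * d.expand p (NeZero.ne p))).map ι) := by
    have h1 := (((hc.expand_self p).mul (hd.comp_mulPoint p)).sub
      (((hc.comp_mulPoint p).mul (hd.expand_self p)).const_mul (p ^ b))).mul
      (HasQExp.prod Finset.univ fun (k : ZMod p) _ ↦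
        (((hc.expand_self p).mul (hd.comp_divPoint p k.val)).const_mul (p ^ a)).sub
        ((hc.comp_divPoint p k.val).mul (hd.expand_self p)))
    convert h1 using 1
    · ext τ
      simp [G]
    · simp [PowerSeries.map_expand, PowerSeries.map_rescale, hz]
  let φ : Option (ZMod p) → ℍ → ℂ := fun γ τ ↦
    p ^ a * (f τ * heckeFamily p w g γ τ) - heckeFamily p 12 f γ τ * g τ
  have hφ : (fun τ ↦ ∏ γ, φ γ τ) = fun τ ↦ (p : ℂ) ^ (a + w) * G τ := by
    ext τ
    simp only [φ, G, Fintype.prod_option, heckeFamily, ← habw]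
    ring
  have hφ' := hG.const_mul (p ^ (a + w))
  rw [← hφ] at hφ'
  have hlevel := (IsLevelOne.prod (w := 12 + w) (φ := φ) (σT := permT p)
    (σS := permS p) (fun γ τ ↦ by
    simp only [φ, heckeFamily_T hf, heckeFamily_T hg, hf.apply_T, hg.apply_T]) (fun γ τ ↦ by
    simp only [φ, heckeFamily_S hf, heckeFamily_S hg, hf.apply_S, hg.apply_S, zpow_natCast]
    ring) hp hφ').const_mul ((p : ℂ) ^ (a + w))⁻¹
  have hG' : (fun τ ↦ ((p : ℂ) ^ (a + w))⁻¹ * ∏ γ, φ γ τ) = G := by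
    ext τ
    rw [congrFun hφ τ, inv_mul_cancel_left₀ (pow_ne_zero _ hp₀)]
  rw [hG'] at hlevel
  have hn' : ((12 + w : ℕ) : ℤ) * Fintype.card (Option (ZMod p)) = (12 * n : ℕ) := by
    rw [Fintype.card_option, ZMod.card, ← hn]
    push_cast
    ring
  rw [hn'] at hlevel
  obtain ⟨h, h1, h2⟩ := hlevel.exists_expand_eq hι hG
  refine ⟨h, h1, fun τ hτ ↦ ?_⟩
  rw [← h2]
  simp only [G, hτ, sub_self, zero_mul]

end

section

open UpperHalfPlane hiding I
open Complex Function ModularGroup Finset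
open scoped PowerSeries

theorem PowerSeries.expand_injective {R : Type*} [CommRing R] {n : ℕ} (hn : n ≠ 0) :
    Injective (expand n hn : R⟦X⟧ →ₐ[R] R⟦X⟧) := fun f g hfg ↦ by
  ext m
  rw [← coeff_expand_mul n hn, hfg, coeff_expand_mul]

theorem PowerSeries.expand_map_intCast {p : ℕ} [Fact p.Prime] {k : Type*} [CommRing k] [CharP k p]
    (c : ℤ⟦X⟧) : (c.map (Int.castRingHom k)).expand p (NeZero.ne p) =
      c.map (Int.castRingHom k) ^ p := by
  have h := MvPowerSeries.map_frobenius_expand (p := p) (hp := NeZero.ne p)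
    (f := c.map (Int.castRingHom k))
  refine Eq.trans ?_ h
  refine Eq.trans ?_ (PowerSeries.map_expand p (NeZero.ne p) (frobenius k p) _).symm
  rw [← RingHom.comp_apply, ← PowerSeries.map_comp,
    RingHom.ext_int ((frobenius k p).comp (Int.castRingHom k)) (Int.castRingHom k)]

section Frobenius

variable {p : ℕ} [Fact p.Prime] {k : Type*} [CommRing k] [CharP k p]

theorem expand_qDisc : (qDisc k).expand p (NeZero.ne p) = qDisc k ^ p :=
  PowerSeries.expand_map_intCast _

theorem expand_qE₄Cube : (qE₄Cube k).expand p (NeZero.ne p) = qE₄Cube k ^ p := by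
  rw [qE₄Cube, map_pow, PowerSeries.expand_map_intCast, ← pow_mul, ← pow_mul, mul_comm]

theorem expand_expand_qDisc : (qDisc k).expand (p * p) (NeZero.ne _) = (qDisc k ^ p) ^ p := by
  rw [PowerSeries.expand_mul p (NeZero.ne p) p (NeZero.ne p), expand_qDisc, map_pow, expand_qDisc]

theorem expand_expand_qE₄Cube :
    (qE₄Cube k).expand (p * p) (NeZero.ne _) = (qE₄Cube k ^ p) ^ p := by
  rw [PowerSeries.expand_mul p (NeZero.ne p) p (NeZero.ne p), expand_qE₄Cube, map_pow,
    expand_qE₄Cube]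

end Frobenius

theorem sum_mul_pow_mul_pow_sub {K : Type*} [Field K] (a : ℕ → K) (n : ℕ) (x : K) {y : K}
    (hy : y ≠ 0) : ∑ i ∈ range (n + 1), a i * x ^ i * y ^ (n - i) =
      y ^ n * ∑ i ∈ range (n + 1), a i * (x / y) ^ i := by
  rw [mul_sum]
  refine sum_congr rfl fun i hi ↦ ?_
  obtain ⟨j, rfl⟩ := Nat.exists_eq_add_of_le (Nat.lt_succ_iff.1 (mem_range.1 hi))
  rw [Nat.add_sub_cancel_left, pow_add, div_pow]
  field_simp

theorem X_pow_dvd_hecke_qDisc {p : ℕ} [Fact p.Prime] {O : Type*} [CommRing O] (a b : O⟦X⟧) (z : O) :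
    PowerSeries.X ^ (p + p) ∣
      ((qDisc O).expand p (NeZero.ne p) - a * (qDisc O).expand (p * p) (NeZero.ne _)) *
      ∏ k : ZMod p, (b * (qDisc O).expand p (NeZero.ne p) -
        PowerSeries.rescale (z ^ k.val) (qDisc O)) := by
  rw [pow_add]
  refine mul_dvd_mul ?_ ?_
  · obtain ⟨U, hU⟩ := PowerSeries.X_dvd_iff.2 (constantCoeff_qDisc (R := O))
    rw [hU, map_mul, map_mul, PowerSeries.expand_X, PowerSeries.expand_X]
    exact dvd_sub (dvd_mul_right _ _) (Dvd.dvd.mul_left (Dvd.dvd.mul_right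
      (pow_dvd_pow _ (Nat.le_mul_self p)) _) _)
  · have : (PowerSeries.X : O⟦X⟧) ^ p = ∏ k : ZMod p, PowerSeries.X := by simp [ZMod.card]
    rw [this]
    refine prod_dvd_prod_of_dvd _ _ fun k _ ↦ PowerSeries.X_dvd_iff.2 ?_
    rw [map_sub, map_mul, PowerSeries.constantCoeff_expand, constantCoeff_qDisc, mul_zero,
      ← PowerSeries.coeff_zero_eq_constantCoeff_apply, PowerSeries.coeff_rescale,
      PowerSeries.coeff_zero_eq_constantCoeff_apply, constantCoeff_qDisc]
    simp

section Reduction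

variable {p : ℕ} [Fact p.Prime] {O : Type*} [CommRing O] {ι : O →+* ℂ} (hι : Injective ι) {z : O}
  (hz : ι z = exp (2 * Real.pi * I / p)) {k : Type*} [Field k] [CharP k p] (π : O →+* k)
include hι hz

theorem map_root_eq_one : π z = 1 := by
  have h : z ^ p = 1 := hι (by
    rw [map_pow, hz, map_one, ← exp_nat_mul, mul_div_cancel₀ _ (Nat.cast_ne_zero.2 (NeZero.ne p)),
      exp_two_pi_mul_I])
  have h' : frobenius k p (π z) = frobenius k p 1 := by
    rw [frobenius_def, frobenius_def, ← map_pow, h, map_one, one_pow]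
  exact frobenius_inj k p h'

theorem exists_hasse_coeff (hp : Odd p) :
    ∃ h : ℕ → O,
      ∑ s ∈ range p, PowerSeries.C (π (h s)) * qE₄Cube k ^ s * qDisc k ^ (p - 1 - s) = -1 ∧
      ∀ τ, ModularForm.discriminant τ = p ^ 6 * ModularForm.discriminant (mulPoint p τ) →
        ∑ i ∈ range p, ι (h i) * (E₄Cube τ / ModularForm.discriminant τ) ^ i = 0 := by
  obtain ⟨h, h1, h2⟩ := exists_coeff_hecke hι hz (a := 6) (b := 6) (w := 0) (n := p + 1)
    rfl rfl isLevelOne_discriminant (g := 1) IsLevelOne.one (c := qDisc O) (d := 1)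
    (by rw [map_qDisc]; exact hasQExp_discriminant)
    (by rw [map_one]; exact HasQExp.const 1)
  simp only [map_one, mul_one] at h1
  have hsum : ∑ i ∈ range p, PowerSeries.C (h i) * qE₄Cube O ^ i * qDisc O ^ (p + 1 - i) =
      qDisc O ^ 2 * ∑ i ∈ range p, PowerSeries.C (h i) * qE₄Cube O ^ i *
        qDisc O ^ (p - 1 - i) := by
    rw [mul_sum]
    refine sum_congr rfl fun i hi ↦ ?_
    have := mem_range.1 hi
    rw [show p + 1 - i = 2 + (p - 1 - i) by omega, pow_add]
    ring
  rw [sum_range_succ, sum_range_succ, hsum] at h1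
  set T := ∑ i ∈ range p, PowerSeries.C (h i) * qE₄Cube O ^ i * qDisc O ^ (p - 1 - i) with hT
  have hcoeff (j : ℕ) (hj : j < 2) := (PowerSeries.coeff_expand_mul p (NeZero.ne p) _ j).symm.trans
    (PowerSeries.X_pow_dvd_iff.1 (h1 ▸ X_pow_dvd_hecke_qDisc _ _ z) (p * j) (by
      have := NeZero.pos p
      nlinarith))
  have htop : h (p + 1) = 0 := by
    have := hcoeff 0 two_pos
    simpa [constantCoeff_qDisc, constantCoeff_qE₄Cube] using this
  have hnext : h p = 0 := by
    have := hcoeff 1 one_lt_two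
    simpa [htop, constantCoeff_qDisc, constantCoeff_qE₄Cube, coeff_one_qDisc,
      PowerSeries.coeff_one_mul, pow_succ, mul_assoc] using this
  refine ⟨h, ?_, fun τ hτ ↦ ?_⟩
  · have hp₀ : (p : k⟦X⟧) = 0 := by
      rw [← map_natCast (PowerSeries.C (R := k)), CharP.cast_eq_zero, map_zero]
    have h3 := congrArg (PowerSeries.map π) h1
    simp only [htop, hnext, map_zero, zero_mul, add_zero, map_mul, map_sub, map_prod, map_pow,
      PowerSeries.map_expand, PowerSeries.map_rescale, map_qDisc, map_natCast,
      map_root_eq_one hι hz π, one_pow, PowerSeries.rescale_one, RingHom.id_apply,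
      hp₀, ne_eq, OfNat.ofNat_ne_zero, not_false_eq_true, zero_pow, sub_zero, zero_sub] at h3
    have h4 : PowerSeries.expand p (NeZero.ne p) (-1 : k⟦X⟧) =
        PowerSeries.expand p (NeZero.ne p) (T.map π) := by
      apply mul_left_cancel₀ (pow_ne_zero (2 * p) (qDisc_ne_zero (R := k)))
      simp only [prod_const, card_univ, ZMod.card, hp.neg_pow, expand_qDisc] at h3
      rw [map_neg, map_one]
      linear_combination h3
    have h5 := PowerSeries.expand_injective (NeZero.ne p) h4
    rw [h5, hT]
    simp [map_qE₄Cube, map_qDisc]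
  · have h3 := h2 τ (by simpa using hτ)
    rw [sum_mul_pow_mul_pow_sub _ _ _ (ModularForm.discriminant_ne_zero τ), sum_range_succ,
      sum_range_succ, htop, hnext] at h3
    simpa [ModularForm.discriminant_ne_zero τ] using h3

theorem exists_frobenius_coeff :
    ∃ d : ℕ → O,
      (∀ x : k, ∑ s ∈ range (2 * (p + 1) + 1), π (d s) * x ^ s = -(x ^ p - x) ^ 2) ∧
      ∀ τ, E₄Cube τ * ModularForm.discriminant (mulPoint p τ) =
          E₄Cube (mulPoint p τ) * ModularForm.discriminant τ →
        ∑ s ∈ range (2 * (p + 1) + 1),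
          ι (d s) * (E₄Cube τ / ModularForm.discriminant τ) ^ s = 0 := by
  obtain ⟨d, h1, h2⟩ := exists_coeff_hecke hι hz (a := 0) (b := 0) (w := 12) (n := 2 * (p + 1))
    rfl (by ring) isLevelOne_E₄Cube isLevelOne_discriminant (c := qE₄Cube O) (d := qDisc O)
    (by rw [map_qE₄Cube]; exact hasQExp_E₄Cube) (by rw [map_qDisc]; exact hasQExp_discriminant)
  refine ⟨d, fun x ↦ ?_, fun τ hτ ↦ ?_⟩
  · have h3 := congrArg (PowerSeries.map π) h1
    simp only [map_sum, map_mul, map_sub, map_prod, map_pow, PowerSeries.map_C,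
      PowerSeries.map_expand, PowerSeries.map_rescale, map_qDisc, map_qE₄Cube,
      map_root_eq_one hι hz π, one_pow, PowerSeries.rescale_one, RingHom.id_apply, pow_zero,
      one_mul, prod_const, card_univ, ZMod.card, expand_qDisc, expand_qE₄Cube,
      expand_expand_qDisc, expand_expand_qE₄Cube] at h3
    have h4 : -(qE₄Cube k * qDisc k ^ p - qE₄Cube k ^ p * qDisc k) ^ 2 =
        ∑ i ∈ range (2 * (p + 1) + 1), PowerSeries.C (π (d i)) * qE₄Cube k ^ i *
          qDisc k ^ (2 * (p + 1) - i) := by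
      apply PowerSeries.expand_injective (NeZero.ne p)
      simp only [map_sum, map_mul, map_neg, map_sub, map_pow, expand_qDisc, expand_qE₄Cube]
      have : CharP k⟦X⟧ p := charP_of_injective_ringHom (PowerSeries.C_injective (R := k)) p
      rw [← h3, sub_pow_char (p := p), mul_pow, mul_pow]
      ring
    have hlt₁ : 2 < 2 * (p + 1) + 1 := by have := NeZero.pos p; omega
    have hlt₂ : p + 1 < 2 * (p + 1) + 1 := by omega
    have hlt₃ : 2 * p < 2 * (p + 1) + 1 := by omega
    have hs₁ : 2 * (p + 1) - 2 = 2 * p := by omega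
    have hs₂ : 2 * (p + 1) - (p + 1) = p + 1 := by omega
    have hs₃ : 2 * (p + 1) - 2 * p = 2 := by omega
    have h5 := PowerSeries.eq_zero_of_coeff_sum_pow_mul_pow constantCoeff_qE₄Cube
      (constantCoeff_qDisc (R := k)) coeff_one_qDisc (n := 2 * (p + 1))
      (r := fun s ↦ π (d s) + (if s = 2 then 1 else 0) - (if s = p + 1 then 2 else 0) +
        if s = 2 * p then 1 else 0) (fun j _ ↦ by
          simp only [map_add, map_sub, add_mul, sub_mul, sum_add_distrib, sum_sub_distrib,
            apply_ite PowerSeries.C, map_one, map_zero, map_ofNat, ite_mul, zero_mul, one_mul,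
            sum_ite_eq', mem_range, ← h4, if_pos hlt₁, if_pos hlt₂, if_pos hlt₃, hs₁, hs₂, hs₃]
          rw [← map_add, ← map_sub, ← map_add]
          convert map_zero (PowerSeries.coeff (R := k) j) using 2
          ring)
    have h6 : ∑ s ∈ range (2 * (p + 1) + 1), (π (d s) + (if s = 2 then 1 else 0) -
        (if s = p + 1 then 2 else 0) + if s = 2 * p then 1 else 0) * x ^ s = 0 :=
      sum_eq_zero fun s hs ↦ by rw [h5 s (Nat.lt_succ_iff.1 (mem_range.1 hs)), zero_mul]
    simp only [add_mul, sub_mul, sum_add_distrib, sum_sub_distrib, ite_mul, zero_mul, one_mul,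
      sum_ite_eq', mem_range, if_pos hlt₁, if_pos hlt₂, if_pos hlt₃] at h6
    linear_combination h6
  · have h3 := h2 τ (by simpa using hτ)
    rw [sum_mul_pow_mul_pow_sub _ _ _ (ModularForm.discriminant_ne_zero τ)] at h3
    simpa [ModularForm.discriminant_ne_zero τ] using h3

end Reduction

end

section Fricke

open UpperHalfPlane hiding I
open Complex

/-- The fixed point `i / √n` of the Fricke involution of level `n`. -/
noncomputable def frickePoint (n : ℕ) [NeZero n] : ℍ :=
  ⟨I / (√n : ℝ), by
    have : 0 < √(n : ℝ) := Real.sqrt_pos.2 (Nat.cast_pos.2 (NeZero.pos n))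
    rw [div_ofReal_im, Complex.I_im]
    exact one_div_pos.2 this⟩

theorem coe_frickePoint_sq (n : ℕ) [NeZero n] : n * (frickePoint n : ℂ) ^ 2 = -1 := by
  have h : ((√n : ℝ) : ℂ) ^ 2 = n := by
    rw [← ofReal_pow, Real.sq_sqrt n.cast_nonneg, ofReal_natCast]
  have hn : (n : ℂ) ≠ 0 := NeZero.ne _
  change (n : ℂ) * (I / (√n : ℝ)) ^ 2 = -1
  rw [div_pow, h, I_sq]
  field_simp

theorem IsLevelOne.apply_frickePoint {f : ℍ → ℂ} (hf : IsLevelOne (12 : ℕ) f) (n : ℕ) [NeZero n] :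
    f (frickePoint n) = n ^ 6 * f (mulPoint n (frickePoint n)) := by
  have h := coe_frickePoint_sq n
  have h₁ : f (mulPoint n (frickePoint n)) =
      ((1 : ℤ) * (frickePoint n : ℂ) + (0 : ℤ)) ^ ((12 : ℕ) : ℤ) * f (frickePoint n) :=
    hf.apply_of_mul_eq (a := 0) (b := -1) (c := 1) (d := 0) (by simp) (by
      simp only [coe_mulPoint]
      push_cast
      linear_combination h)
  rw [h₁, zpow_natCast]
  push_cast
  linear_combination (-f (frickePoint n)) * congrArg (· ^ 6) h

end Fricke

section Place

/-- A field of characteristic zero has a valuation ring in which a given prime is not a unit. -/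
theorem ValuationSubring.exists_charP_residueField (K : Type*) [Field K] [CharZero K] (p : ℕ)
    [hp : Fact p.Prime] :
    ∃ B : ValuationSubring K, CharP (IsLocalRing.ResidueField B) p := by
  have hinj : Function.Injective (Int.castRingHom K) := Int.cast_injective
  let A : Subring K := (Int.castRingHom K).range
  let e : ℤ ≃+* A := RingEquiv.ofBijective (Int.castRingHom K).rangeRestrict
    ⟨fun x y h ↦ hinj (congrArg Subtype.val h), RingHom.rangeRestrict_surjective _⟩
  have hI : Ideal.span {(p : A)} ≠ ⊤ := by
    rw [Ne, Ideal.span_singleton_eq_top]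
    intro h
    have := h.map e.symm
    rw [map_natCast, Int.isUnit_iff_natAbs_eq, Int.natAbs_natCast] at this
    exact hp.1.one_lt.ne' this
  obtain ⟨B, -, hB⟩ := Ideal.image_subset_nonunits_valuationSubring _ hI
  refine ⟨B, ?_⟩
  have h : ((p : B) : K) ∈ B.nonunits :=
    hB ⟨p, Ideal.mem_span_singleton_self _, by simp⟩
  rw [ValuationSubring.coe_mem_nonunits_iff] at h
  have h₀ : (p : IsLocalRing.ResidueField B) = 0 := by
    rw [← map_natCast (IsLocalRing.residue B), IsLocalRing.residue_eq_zero_iff]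
    exact h
  exact (CharP.charP_iff_prime_eq_zero hp.1).2 h₀

theorem ValuationSubring.mem_of_sum_pow_eq_zero {K : Type*} [Field K] {B : ValuationSubring K}
    {n : ℕ} {h : ℕ → B} (hn : IsUnit (h n)) {x : K}
    (hx : ∑ i ∈ Finset.range (n + 1), (h i : K) * x ^ i = 0) : x ∈ B := by
  have hxB : IsIntegral B x := by
    obtain ⟨u, hu⟩ := hn
    refine ⟨Polynomial.X ^ n + ∑ i ∈ Finset.range n, Polynomial.C (↑u⁻¹ * h i) * Polynomial.X ^ i,
      Polynomial.monic_X_pow_add ?_, ?_⟩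
    · rw [← Fin.sum_univ_eq_sum_range (fun i ↦ Polynomial.C (↑u⁻¹ * h i) * Polynomial.X ^ i)]
      exact Polynomial.degree_sum_fin_lt _
    · have hu' : ((↑u⁻¹ : B) : K) * (h n : K) = 1 := by
        rw [← hu]
        exact_mod_cast congrArg (Subtype.val (p := (· ∈ B))) u.inv_mul
      rw [Finset.sum_range_succ] at hx
      simp only [Polynomial.eval₂_add, Polynomial.eval₂_pow, Polynomial.eval₂_X,
        Polynomial.eval₂_finsetSum, Polynomial.eval₂_mul, Polynomial.eval₂_C, map_mul]
      change x ^ n + ∑ i ∈ Finset.range n, ((↑u⁻¹ : B) : K) * (h i : K) * x ^ i = 0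
      simp_rw [mul_assoc]
      rw [← Finset.mul_sum]
      linear_combination ((↑u⁻¹ : B) : K) * hx - x ^ n * hu'
  obtain ⟨y, hy⟩ := IsIntegrallyClosed.isIntegral_iff.1 hxB
  rw [← hy]
  exact y.2

theorem ValuationSubring.mem_of_pow_eq_one {K : Type*} [Field K] (B : ValuationSubring K)
    {n : ℕ} (hn : n ≠ 0) {x : K} (hx : x ^ n = 1) : x ∈ B := by
  have hxB : IsIntegral B x :=
    .of_pow (Nat.pos_of_ne_zero hn) (by rw [hx]; exact isIntegral_one)
  obtain ⟨y, hy⟩ := IsIntegrallyClosed.isIntegral_iff.1 hxB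
  rw [← hy]
  exact y.2

end Place

section Small

theorem WeierstrassCurve.card_point_of_isElliptic {R : Type*} [Field R] (W : WeierstrassCurve R)
    [W.IsElliptic] [Finite R] :
    Nat.card W.toAffine.Point = Nat.card {P : R × R // W.toAffine.Equation P.1 P.2} + 1 := by
  have e : W.toAffine.Point ≃ Option {P : R × R // W.toAffine.Equation P.1 P.2} :=
    { toFun := fun P ↦ match P with
        | .zero => none
        | .some x y h => some ⟨(x, y), Affine.equation_iff_nonsingular.2 h⟩
      invFun := fun P ↦ match P with
        | none => .zero
        | some P => .some P.1.1 P.1.2 (Affine.equation_iff_nonsingular.1 P.2)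
      left_inv := by rintro (_ | _) <;> rfl
      right_inv := by rintro (_ | _) <;> rfl }
  rw [Nat.card_congr e, Finite.card_option]

theorem exists_card_point_eq_three : ∃ W : WeierstrassCurve (ZMod 2), W.IsElliptic ∧
    Nat.card W.toAffine.Point = 3 := by
  have h : (⟨0, 0, 1, 0, 0⟩ : WeierstrassCurve (ZMod 2)).IsElliptic := ⟨by
    simp only [WeierstrassCurve.Δ, WeierstrassCurve.b₂, WeierstrassCurve.b₄, WeierstrassCurve.b₆,
      WeierstrassCurve.b₈]
    decide⟩
  refine ⟨_, h, ?_⟩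
  rw [WeierstrassCurve.card_point_of_isElliptic]
  simp only [WeierstrassCurve.Affine.equation_iff]
  rw [Nat.card_eq_fintype_card]
  decide

theorem exists_card_point_eq_four : ∃ W : WeierstrassCurve (ZMod 3), W.IsElliptic ∧
    Nat.card W.toAffine.Point = 4 := by
  have h : (WeierstrassCurve.short (-1) 0 : WeierstrassCurve (ZMod 3)).IsElliptic := ⟨by
    rw [WeierstrassCurve.short_Δ]
    decide⟩
  refine ⟨_, h, ?_⟩
  rw [WeierstrassCurve.card_point_of_isElliptic]
  simp only [WeierstrassCurve.Affine.equation_iff, WeierstrassCurve.short]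
  rw [Nat.card_eq_fintype_card]
  decide

end Small

section Main

open Finset Complex

/-- Modulo a place of `ℂ` above `p`, the value of the modular invariant at the fixed point of the
Fricke involution is a supersingular invariant lying in the prime field. -/
theorem exists_zero_hasse_coeff (p : ℕ) [hp : Fact p.Prime] (hp' : Odd p) :
    ∃ (k : Type) (_ : Field k) (_ : CharP k p) (h : ℕ → k) (x : ZMod p),
      ∑ s ∈ range p, PowerSeries.C (h s) * qE₄Cube k ^ s * qDisc k ^ (p - 1 - s) = -1 ∧
      ∑ s ∈ range p, h s * ZMod.castHom dvd_rfl k x ^ s = 0 := by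
  obtain ⟨B, hB⟩ := ValuationSubring.exists_charP_residueField ℂ p
  have hp₀ : p ≠ 0 := hp.1.ne_zero
  let ι : B →+* ℂ := B.subtype
  have hι : Function.Injective ι := B.subtype_injective
  let π := IsLocalRing.residue B
  have hz₁ : exp (2 * Real.pi * I / p) ∈ B :=
    B.mem_of_pow_eq_one hp₀ (Complex.isPrimitiveRoot_exp p hp₀).pow_eq_one
  have hz : ι ⟨_, hz₁⟩ = exp (2 * Real.pi * I / p) := rfl
  obtain ⟨h, hh₁, hh₂⟩ := exists_hasse_coeff hι hz π hp'
  obtain ⟨d, hd₁, hd₂⟩ := exists_frobenius_coeff hι hz π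
  have hΔ := isLevelOne_discriminant.apply_frickePoint p
  have hE := isLevelOne_E₄Cube.apply_frickePoint p
  specialize hh₂ _ hΔ
  specialize hd₂ (frickePoint p) (by rw [hE, hΔ]; ring)
  have hs : p - 1 + 1 = p := Nat.succ_pred hp₀
  have hlead : π (h (p - 1)) = -1 := by
    have := congrArg PowerSeries.constantCoeff hh₁
    rw [← hs] at this
    simp only [sum_range_succ, map_add, map_sum, map_mul, map_pow, PowerSeries.constantCoeff_C,
      constantCoeff_qE₄Cube, constantCoeff_qDisc, Nat.add_sub_cancel, tsub_self] at this
    rw [sum_eq_zero fun i hi ↦ by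
      rw [zero_pow (Nat.sub_ne_zero_of_lt (mem_range.1 hi)), mul_zero]] at this
    simpa using this
  have hunit : IsUnit (h (p - 1)) := by
    rw [← IsLocalRing.residue_ne_zero_iff_isUnit]
    change π (h (p - 1)) ≠ 0
    simp [hlead]
  have hmem := ValuationSubring.mem_of_sum_pow_eq_zero hunit (by rw [hs]; exact hh₂)
  obtain ⟨j, hj⟩ : ∃ j : B, ι j = E₄Cube (frickePoint p) /
      ModularForm.discriminant (frickePoint p) := ⟨⟨_, hmem⟩, rfl⟩
  rw [← hj] at hh₂ hd₂
  simp only [← map_pow, ← map_mul, ← map_sum, map_eq_zero_iff ι hι] at hh₂ hd₂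
  have hh₃ : ∑ i ∈ range p, π (h i) * π j ^ i = 0 := by
    simpa only [map_sum, map_mul, map_pow, map_zero] using congrArg π hh₂
  have hd₃ : -(π j ^ p - π j) ^ 2 = 0 := by
    rw [← hd₁]
    simpa only [map_sum, map_mul, map_pow, map_zero] using congrArg π hd₂
  have hj₁ : π j ∈ (⊥ : Subfield (IsLocalRing.ResidueField B)) := by
    rw [Subfield.mem_bot_iff_pow_eq_self _ p]
    exact sub_eq_zero.1 (pow_eq_zero_iff two_ne_zero |>.1 (neg_eq_zero.1 hd₃))
  rw [← ZMod.fieldRange_castHom_eq_bot p] at hj₁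
  obtain ⟨x, hx⟩ := hj₁
  exact ⟨_, inferInstance, hB, fun i ↦ π (h i), x, hh₁, by rw [hx]; exact hh₃⟩

/-- Every value of the modular invariant is attained by some `E₄`, `E₆` and `Δ`. -/
theorem exists_invariants {F : Type*} [Field F] (h₂ : (2 : F) ≠ 0) (h₃ : (3 : F) ≠ 0) (j : F) :
    ∃ x y d : F, d ≠ 0 ∧ 1728 * d = x ^ 3 - y ^ 2 ∧ x ^ 3 = j * d := by
  have h : (1728 : F) ≠ 0 := by
    rw [show (1728 : F) = 2 ^ 6 * 3 ^ 3 by norm_num]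
    exact mul_ne_zero (pow_ne_zero _ h₂) (pow_ne_zero _ h₃)
  rcases eq_or_ne j 0 with rfl | hj₀
  · exact ⟨0, 1, -1 / 1728, div_ne_zero (neg_ne_zero.2 one_ne_zero) h, by field_simp; ring,
      by ring⟩
  rcases eq_or_ne j 1728 with rfl | hj
  · exact ⟨1, 0, 1 / 1728, one_div_ne_zero h, by field_simp; ring, by field_simp⟩
  · exact ⟨j * (j - 1728), j * (j - 1728) ^ 2, j ^ 2 * (j - 1728) ^ 3,
      mul_ne_zero (pow_ne_zero _ hj₀) (pow_ne_zero _ (sub_ne_zero.2 hj)), by ring, by ring⟩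

theorem WeierstrassCurve.map_shortCubic {R S : Type*} [CommRing R] [CommRing S] (φ : R →+* S)
    (a b : R) : (shortCubic a b).map φ = shortCubic (φ a) (φ b) := by
  simp [shortCubic]

theorem exists_card_point_eq_add_one_of_five_le (p : ℕ) [hp : Fact p.Prime] (hp' : 5 ≤ p) :
    ∃ W : WeierstrassCurve (ZMod p), W.IsElliptic ∧ Nat.card W.toAffine.Point = p + 1 := by
  have hne (n : ℕ) (hn₀ : n ≠ 0) (hn : n < p) : (n : ZMod p) ≠ 0 := fun h ↦
    (Nat.le_of_dvd (Nat.pos_of_ne_zero hn₀) ((ZMod.natCast_eq_zero_iff _ _).1 h)).not_gt hn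
  have h₂ : (2 : ZMod p) ≠ 0 := by exact_mod_cast hne 2 (by simp) (by lia)
  have h₃ : (3 : ZMod p) ≠ 0 := by exact_mod_cast hne 3 (by simp) (by lia)
  obtain ⟨k, _, _, h, j, hh, hj⟩ := exists_zero_hasse_coeff p
    (hp.1.odd_of_ne_two (by lia))
  obtain ⟨x, y, d, hd₀, hd, hx⟩ := exists_invariants h₂ h₃ j
  let φ : ZMod p →+* k := ZMod.castHom dvd_rfl k
  have hφ : Function.Injective φ := φ.injective
  have hell : (WeierstrassCurve.short (-27 * x) (-54 * y)).IsElliptic := ⟨by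
    rw [WeierstrassCurve.short_Δ, isUnit_iff_ne_zero, show -16 * (4 * (-27 * x) ^ 3 +
      27 * (-54 * y) ^ 2) = 2 ^ 12 * 3 ^ 12 * d by linear_combination (-2 ^ 6 * 3 ^ 9) * hd]
    exact mul_ne_zero (mul_ne_zero (pow_ne_zero _ h₂) (pow_ne_zero _ h₃)) hd₀⟩
  refine ⟨_, hell, WeierstrassCurve.card_point_short_of_coeff_eq_zero hp' _ _ (hφ ?_)⟩
  rw [map_zero, ← Polynomial.coeff_map, Polynomial.map_pow, WeierstrassCurve.map_shortCubic]
  let ψ := Int.castRingHom k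
  have hs : p - 1 + 1 = p := Nat.succ_pred hp.1.ne_zero
  have hz : ∑ s ∈ range p, h s * (φ x ^ 3) ^ s * φ d ^ (p - 1 - s) = 0 := by
    have hd' : φ d ≠ 0 := (map_ne_zero φ).2 hd₀
    have := sum_mul_pow_mul_pow_sub h (p - 1) (φ x ^ 3) hd'
    rw [hs] at this
    rw [this, ← map_pow φ x, hx, map_mul, mul_div_cancel_right₀ _ hd', hj, mul_zero]
  have := WeierstrassCurve.hasse_coeff_eq_zero hp' (E₂ := qE₂.map ψ) (E₄ := qE₄.map ψ)
    (E₆ := qE₆.map ψ) (D := qΔ.map ψ)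
    (by simpa [PowerSeries.map_derivative, map_ofNat] using
      congrArg (PowerSeries.map ψ) qE₂_ramanujan)
    (by simpa [PowerSeries.map_derivative, map_ofNat] using
      congrArg (PowerSeries.map ψ) qE₄_ramanujan)
    (by simpa [PowerSeries.map_derivative, map_ofNat] using
      congrArg (PowerSeries.map ψ) qE₆_ramanujan)
    (by simpa [map_ofNat] using congrArg (PowerSeries.map ψ) qΔ_eq)
    (by simp [PowerSeries.constantCoeff_map_apply, constantCoeff_qE₄])
    (by simp [PowerSeries.constantCoeff_map_apply, constantCoeff_qΔ])
    (by simp [coeff_one_qΔ])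
    (h := h) hh
    (x := φ x) (y := φ y) (d := φ d)
    (by simpa [map_ofNat] using congrArg φ hd) hz
  simpa [map_ofNat] using this

end Main

/-- For every prime `p` there exists an elliptic curve over `𝔽_p = ZMod p`
(given as a Weierstrass curve with unit discriminant) with exactly `p + 1`
rational points, i.e. a supersingular elliptic curve of Frobenius trace zero. -/
theorem exists_elliptic_curve_card_eq_p_add_one (p : ℕ) (hp : p.Prime) :
    ∃ W : WeierstrassCurve (ZMod p), W.IsElliptic ∧
      Nat.card W.toAffine.Point = p + 1 := by
  have : Fact p.Prime := ⟨hp⟩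
  rcases lt_or_ge p 5 with h | h
  · have := hp.two_le
    interval_cases p
    · exact exists_card_point_eq_three
    · exact exists_card_point_eq_four
    · exact absurd hp (by decide)
  · exact exists_card_point_eq_add_one_of_five_le p h
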